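/- arXiv:2205.06466 — 6 statements merged into one kernel-verified Lean document; each statement's English description precedes it below -/
import Mathlib

section
/- Every sentence of FO(=(·), 𝒟↑, ⊔) — First Order Logic with team semantics augmented with constancy atoms, all upwards closed first order dependencies, and global disjunctions — is equivalent to some first-order sentence. -/
open FirstOrder FirstOrder.Language

/-- A `k`-ary dependency: an isomorphism-closed class of models `(A, R)` where `R` is a
`k`-ary relation on the domain `A`. -/
structure Dependency (k : ℕ) : Type 1 where
  Mem : ∀ (A : Type), Set (Fin k → A) → Prop
  iso_closed : ∀ {A B : Type} (e : A ≃ B) (R : Set (Fin k → A)),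
    Mem A R → Mem B ((fun (t : Fin k → A) (i : Fin k) => e (t i)) '' R)

/-- `Fld R` is the set of all elements occurring in some position of some tuple of `R`. -/
def Fld {k : ℕ} {A : Type} (R : Set (Fin k → A)) : Set A :=
  {a | ∃ t ∈ R, ∃ i, t i = a}

/-- A dependency is domain independent if `(A, R) ∈ D ↔ (Fld R, R) ∈ D`. -/
def Dependency.DomainIndependent {k : ℕ} (D : Dependency k) : Prop :=
  ∀ (A : Type) (R : Set (Fin k → A)),
    D.Mem A R ↔ D.Mem (Fld R) {t : Fin k → (Fld R) | (fun i => (t i : A)) ∈ R}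

/-- A dependency is union closed if it is closed under unions of arbitrary
(possibly empty) families of relations on a fixed domain. -/
def Dependency.UnionClosed {k : ℕ} (D : Dependency k) : Prop :=
  ∀ (A : Type) (I : Type) (R : I → Set (Fin k → A)),
    (∀ i, D.Mem A (R i)) → D.Mem A (⋃ i, R i)

def Dependency.DownwardsClosed {k : ℕ} (D : Dependency k) : Prop :=
  ∀ (A : Type) (R S : Set (Fin k → A)), D.Mem A R → S ⊆ R → D.Mem A S

def Dependency.UpwardsClosed {k : ℕ} (D : Dependency k) : Prop :=
  ∀ (A : Type) (R S : Set (Fin k → A)), D.Mem A R → R ⊆ S → D.Mem A S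

def Dependency.EmptyTeamProperty {k : ℕ} (D : Dependency k) : Prop :=
  ∀ A : Type, D.Mem A (∅ : Set (Fin k → A))

/-- `teamMap X xs` is `X(x⃗)`: the set of values of the tuple of variables `xs` over the team `X`. -/
def teamMap {M : Type} (X : Set (ℕ → M)) {n : ℕ} (xs : Fin n → ℕ) : Set (Fin n → M) :=
  {t | ∃ s ∈ X, t = fun j => s (xs j)}

/-- The signature `{R}` with a single `k`-ary relation symbol. -/
def relLang (k : ℕ) : FirstOrder.Language.{0,0} where
  Functions := fun _ => Empty
  Relations := fun n => PLift (n = k)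

/-- The `{R}`-structure on `A` in which `R` is interpreted as the `k`-ary relation `R`. -/
def relStructure {k : ℕ} (A : Type) (R : Set (Fin k → A)) : (relLang k).Structure A where
  funMap := fun f _ => f.elim
  RelMap := fun {n} r x => (fun i : Fin k => x (Fin.cast r.down.symm i)) ∈ R

/-- A dependency is first order if, as a property of relations, it is definable by a
first-order sentence over the signature `{R}`. -/
def Dependency.IsFirstOrder {k : ℕ} (D : Dependency k) : Prop :=
  ∃ ψ : (relLang k).Sentence,
    ∀ (A : Type) [Nonempty A] (R : Set (Fin k → A)),
      D.Mem A R ↔ (letI := relStructure A R; Sentence.Realize A ψ)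

/-- Formulas of `FO(=(·), 𝒟↑, ⊔)`: first-order logic with team semantics over `L`, extended by
constancy atoms, dependency atoms for arbitrary upwards closed first order dependencies
(the class `𝒟↑`), and global disjunctions. -/
inductive TSGFormula (L : FirstOrder.Language.{0,0}) : Type 1
  | rel {n : ℕ} (r : L.Relations n) (ts : Fin n → L.Term ℕ)
  | nrel {n : ℕ} (r : L.Relations n) (ts : Fin n → L.Term ℕ)
  | equal (t₁ t₂ : L.Term ℕ)
  | nequal (t₁ t₂ : L.Term ℕ)
  | constancy (n : ℕ) (xs : Fin n → ℕ)
  | depAtom {k : ℕ} (D : Dependency k) (hup : D.UpwardsClosed) (hfo : D.IsFirstOrder)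
      (xs : Fin k → ℕ)
  | conj (φ ψ : TSGFormula L)
  | disj (φ ψ : TSGFormula L)
  | glob (φ ψ : TSGFormula L)
  | ex (v : ℕ) (φ : TSGFormula L)
  | fa (v : ℕ) (φ : TSGFormula L)

variable {L : FirstOrder.Language.{0,0}}

/-- Team semantics for `FO(=(·), 𝒟↑, ⊔)`. -/
def TSGFormula.Sat (M : Type) [L.Structure M] : TSGFormula L → Set (ℕ → M) → Prop
  | .rel r ts, X => ∀ s ∈ X, Structure.RelMap r (fun i => (ts i).realize s)
  | .nrel r ts, X => ∀ s ∈ X, ¬ Structure.RelMap r (fun i => (ts i).realize s)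
  | .equal t₁ t₂, X => ∀ s ∈ X, t₁.realize s = t₂.realize s
  | .nequal t₁ t₂, X => ∀ s ∈ X, t₁.realize s ≠ t₂.realize s
  | .constancy _ xs, X => ∀ s ∈ X, ∀ s' ∈ X, ∀ j, s (xs j) = s' (xs j)
  | .depAtom D _ _ xs, X => D.Mem M (teamMap X xs)
  | .conj φ ψ, X => φ.Sat M X ∧ ψ.Sat M X
  | .disj φ ψ, X => ∃ Y Z : Set (ℕ → M), X = Y ∪ Z ∧ φ.Sat M Y ∧ ψ.Sat M Z
  | .glob φ ψ, X => φ.Sat M X ∨ ψ.Sat M X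
  | .ex v φ, X => ∃ H : (ℕ → M) → Set M, (∀ s ∈ X, (H s).Nonempty) ∧
      φ.Sat M {s' | ∃ s ∈ X, ∃ m ∈ H s, s' = Function.update s v m}
  | .fa v φ, X => φ.Sat M {s' | ∃ s ∈ X, ∃ m : M, s' = Function.update s v m}

/-- The set of variables of a first-order term. -/
def gTermVars : L.Term ℕ → Set ℕ
  | .var x => {x}
  | .func _f ts => ⋃ i, gTermVars (ts i)

/-- The free variables of a formula of `FO(=(·), 𝒟↑, ⊔)`. -/
def TSGFormula.freeVars : TSGFormula L → Set ℕ
  | .rel _ ts => ⋃ i, gTermVars (ts i)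
  | .nrel _ ts => ⋃ i, gTermVars (ts i)
  | .equal t₁ t₂ => gTermVars t₁ ∪ gTermVars t₂
  | .nequal t₁ t₂ => gTermVars t₁ ∪ gTermVars t₂
  | .constancy _ xs => Set.range xs
  | .depAtom _ _ _ xs => Set.range xs
  | .conj φ ψ => φ.freeVars ∪ ψ.freeVars
  | .disj φ ψ => φ.freeVars ∪ ψ.freeVars
  | .glob φ ψ => φ.freeVars ∪ ψ.freeVars
  | .ex v φ => φ.freeVars \ {v}
  | .fa v φ => φ.freeVars \ {v}

/-- Truth of a sentence of `FO(=(·), 𝒟↑, ⊔)` in a model. -/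
def TSGFormula.TrueIn (M : Type) [L.Structure M] (φ : TSGFormula L) : Prop :=
  ∀ s : ℕ → M, φ.Sat M {s}

/-- A property of tuples `α → M`, given uniformly in the nonempty model `M`, is definable by a
first-order formula. -/
def FODef {α : Type}
    (Q : ∀ (M : Type) [L.Structure M] [Nonempty M], (α → M) → Prop) : Prop :=
  ∃ θ : L.Formula α, ∀ (M : Type) [L.Structure M] [Nonempty M] (e : α → M),
    θ.Realize e ↔ Q M e

namespace FODef

variable {α β : Type} {Q Q' : ∀ (M : Type) [L.Structure M] [Nonempty M], (α → M) → Prop}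

theorem of_iff (h : FODef Q)
    (hQ : ∀ (M : Type) [L.Structure M] [Nonempty M] (e : α → M), Q M e ↔ Q' M e) :
    FODef Q' := by
  obtain ⟨θ, hθ⟩ := h
  exact ⟨θ, fun M _ _ e => (hθ M e).trans (hQ M e)⟩

theorem formula (θ : L.Formula α) : FODef (L := L) fun M _ _ e => θ.Realize e :=
  ⟨θ, fun _ _ _ _ => Iff.rfl⟩

theorem false : FODef (L := L) (α := α) fun _ _ _ _ => False :=
  ⟨⊥, fun _ _ _ _ => by simp⟩

theorem true : FODef (L := L) (α := α) fun _ _ _ _ => True :=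
  ⟨⊤, fun _ _ _ _ => by simp⟩

theorem var_eq (a b : α) : FODef (L := L) fun _ _ _ e => e a = e b :=
  ⟨(Term.var a).equal (Term.var b), fun _ _ _ _ => by simp⟩

theorem and (h : FODef Q) (h' : FODef Q') : FODef (L := L) fun M _ _ e => Q M e ∧ Q' M e := by
  obtain ⟨θ, hθ⟩ := h
  obtain ⟨θ', hθ'⟩ := h'
  exact ⟨θ ⊓ θ', fun M _ _ e => by simp [hθ, hθ']⟩

theorem or (h : FODef Q) (h' : FODef Q') : FODef (L := L) fun M _ _ e => Q M e ∨ Q' M e := by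
  obtain ⟨θ, hθ⟩ := h
  obtain ⟨θ', hθ'⟩ := h'
  exact ⟨θ ⊔ θ', fun M _ _ e => by simp [hθ, hθ']⟩

theorem imp (h : FODef Q) (h' : FODef Q') : FODef (L := L) fun M _ _ e => Q M e → Q' M e := by
  obtain ⟨θ, hθ⟩ := h
  obtain ⟨θ', hθ'⟩ := h'
  exact ⟨θ.imp θ', fun M _ _ e => by simp [hθ, hθ']⟩

theorem not (h : FODef Q) : FODef (L := L) fun M _ _ e => ¬ Q M e := by
  obtain ⟨θ, hθ⟩ := h
  exact ⟨θ.not, fun M _ _ e => by simp [hθ]⟩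

theorem relabel (h : FODef Q) (f : α → β) : FODef (L := L) fun M _ _ e => Q M (e ∘ f) := by
  obtain ⟨θ, hθ⟩ := h
  exact ⟨θ.relabel f, fun M _ _ e => by simp [hθ]⟩

theorem forall_finite {ι : Type} [Finite ι]
    {P : ι → ∀ (M : Type) [L.Structure M] [Nonempty M], (α → M) → Prop}
    (h : ∀ i, FODef (P i)) : FODef (L := L) fun M _ _ e => ∀ i, P i M e := by
  choose θ hθ using h
  exact ⟨Formula.iInf θ, fun M _ _ e => by simp [hθ]⟩

/-- Quantification over assignments to an arbitrary, possibly infinite, set of variables. -/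
theorem exists_fun {P : ∀ (M : Type) [L.Structure M] [Nonempty M], (α ⊕ β → M) → Prop}
    (h : FODef P) : FODef (L := L) fun M _ _ e => ∃ b : β → M, P M (Sum.elim e b) := by
  classical
  obtain ⟨θ, hθ⟩ := h
  let S := {b : β // Sum.inr b ∈ θ.freeVarFinset}
  have : Finite S := Finite.of_injective
    (fun b : S => (⟨Sum.inr b.1, b.2⟩ : θ.freeVarFinset))
    (fun b c hbc => Subtype.ext (Sum.inr_injective (congrArg Subtype.val hbc)))
  let f : θ.freeVarFinset → α ⊕ S := fun x => match x with
    | ⟨Sum.inl a, _⟩ => Sum.inl a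
    | ⟨Sum.inr b, hb⟩ => Sum.inr ⟨b, hb⟩
  refine ⟨Formula.iExs S (θ.restrictFreeVar f : L.Formula (α ⊕ S)), fun M _ _ e => ?_⟩
  rw [Formula.realize_iExs]
  have key : ∀ b : β → M,
      Formula.Realize (θ.restrictFreeVar f : L.Formula (α ⊕ S)) (Sum.elim e (fun x => b x.1)) ↔
        P M (Sum.elim e b) := fun b => by
    rw [← hθ]
    refine BoundedFormula.realize_restrictFreeVar (Sum.elim e b) ?_
    rintro ⟨a | b, hx⟩ <;> rfl
  constructor
  · rintro ⟨i, hi⟩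
    refine ⟨fun b => if hb : Sum.inr b ∈ θ.freeVarFinset then i ⟨b, hb⟩
      else Classical.arbitrary M, (key _).1 ?_⟩
    convert hi using 3 with x
    simp [x.2]
  · rintro ⟨b, hb⟩
    exact ⟨_, (key b).2 hb⟩

theorem forall_fun {P : ∀ (M : Type) [L.Structure M] [Nonempty M], (α ⊕ β → M) → Prop}
    (h : FODef P) : FODef (L := L) fun M _ _ e => ∀ b : β → M, P M (Sum.elim e b) :=
  h.not.exists_fun.not.of_iff fun M _ _ e => by simp

theorem exists_elem {P : ∀ (M : Type) [L.Structure M] [Nonempty M], (α → M) → M → Prop}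
    (h : FODef (L := L) (α := α ⊕ Unit) fun M _ _ e => P M (e ∘ Sum.inl) (e (Sum.inr ()))) :
    FODef (L := L) fun M _ _ e => ∃ m, P M e m :=
  h.exists_fun.of_iff fun M _ _ e =>
    ⟨fun ⟨b, hb⟩ => ⟨b (), hb⟩, fun ⟨m, hm⟩ => ⟨fun _ => m, hm⟩⟩

theorem forall_elem {P : ∀ (M : Type) [L.Structure M] [Nonempty M], (α → M) → M → Prop}
    (h : FODef (L := L) (α := α ⊕ Unit) fun M _ _ e => P M (e ∘ Sum.inl) (e (Sum.inr ()))) :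
    FODef (L := L) fun M _ _ e => ∀ m, P M e m :=
  h.forall_fun.of_iff fun M _ _ e =>
    ⟨fun hb m => hb fun _ => m, fun hm b => hm (b ())⟩

theorem exists_mem_list {ι : Type*} (l : List ι)
    {P : ι → ∀ (M : Type) [L.Structure M] [Nonempty M], (α → M) → Prop}
    (h : ∀ i, FODef (P i)) : FODef (L := L) fun M _ _ e => ∃ i ∈ l, P i M e := by
  induction l with
  | nil => exact FODef.false.of_iff fun M _ _ e => by simp
  | cons a l ih => exact ((h a).or ih).of_iff fun M _ _ e => by simp

/-- A first-order property of a definable relation is definable. -/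
theorem realize_relStructure {k : ℕ}
    {R : ∀ (M : Type) [L.Structure M] [Nonempty M], (α → M) → Set (Fin k → M)}
    (hR : FODef (L := L) (α := α ⊕ Fin k) fun M _ _ e => e ∘ Sum.inr ∈ R M (e ∘ Sum.inl))
    {n : ℕ} (ψ : (relLang k).BoundedFormula Empty n) :
    FODef (L := L) (α := α ⊕ Fin n) fun M _ _ e =>
      @BoundedFormula.Realize (relLang k) M (relStructure M (R M (e ∘ Sum.inl))) _ _ ψ
        default (e ∘ Sum.inr) := by
  have hterm : ∀ {n : ℕ} (t : (relLang k).Term (Empty ⊕ Fin n)), ∃ i : Fin n,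
      ∀ (M : Type) (S : Set (Fin k → M)) (b : Fin n → M),
        @Term.realize (relLang k) M (relStructure M S) _ (Sum.elim default b) t = b i := by
    intro n t
    match t with
    | .var (Sum.inr i) => exact ⟨i, fun _ _ _ => rfl⟩
    | .func f _ => exact f.elim
  induction ψ with
  | falsum => exact FODef.false
  | equal t₁ t₂ =>
    obtain ⟨i, hi⟩ := hterm t₁
    obtain ⟨j, hj⟩ := hterm t₂
    refine (FODef.var_eq (Sum.inr i) (Sum.inr j)).of_iff fun M _ _ e => ?_
    simp only [BoundedFormula.Realize, hi, hj, Function.comp]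
  | rel r ts =>
    choose i hi using fun j => hterm (ts j)
    refine (hR.relabel (Sum.map id fun j => i (Fin.cast r.down.symm j))).of_iff
      fun M _ _ e => ?_
    simp only [BoundedFormula.Realize, hi]
    rfl
  | imp _ _ ih₁ ih₂ => exact ih₁.imp ih₂
  | @all n ψ ih =>
    let f : α ⊕ Fin (n + 1) → (α ⊕ Fin n) ⊕ Unit :=
      Sum.elim (Sum.inl ∘ Sum.inl) (Fin.snoc (Sum.inl ∘ Sum.inr) (Sum.inr ()))
    refine (FODef.forall_elem (P := fun M _ _ e m =>
      @BoundedFormula.Realize (relLang k) M (relStructure M (R M (e ∘ Sum.inl))) _ _ ψ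
        default (Fin.snoc (e ∘ Sum.inr) m)) ((ih.relabel f).of_iff fun M _ _ e => ?_)).of_iff
          fun M _ _ e => Iff.rfl
    have : (e ∘ f) ∘ Sum.inr = Fin.snoc ((e ∘ Sum.inl) ∘ Sum.inr) (e (Sum.inr ())) := by
      funext j
      refine Fin.lastCases ?_ (fun j => ?_) j <;> simp [f]
    rw [this]
    rfl

end FODef

/-- A team, given uniformly in a nonempty model `M` and parameters `α → M`, is definable if
first-order quantification over its assignments is first-order expressible. -/
def DefTeam {α : Type}
    (T : ∀ (M : Type) [L.Structure M] [Nonempty M], (α → M) → Set (ℕ → M)) : Prop :=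
  ∀ (γ : Type) (f : α → γ)
    (P : ∀ (M : Type) [L.Structure M] [Nonempty M], (γ ⊕ ℕ → M) → Prop), FODef P →
      FODef (L := L) fun M _ _ e => ∃ s ∈ T M (e ∘ f), P M (Sum.elim e s)

namespace DefTeam

variable {α : Type} {T : ∀ (M : Type) [L.Structure M] [Nonempty M], (α → M) → Set (ℕ → M)}

theorem singleton (g : ℕ → α) : DefTeam (L := L) fun _ _ _ e => {e ∘ g} := by
  intro γ f P hP
  refine (hP.relabel (Sum.elim id (f ∘ g))).of_iff fun M _ _ e => ?_
  simp [Sum.comp_elim, Function.comp_assoc]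

theorem filter (hT : DefTeam T) (g : ℕ → α)
    {F : ∀ (M : Type) [L.Structure M] [Nonempty M], (ℕ ⊕ ℕ → M) → Prop} (hF : FODef F) :
    DefTeam (L := L) fun M _ _ e => {s ∈ T M e | F M (Sum.elim (e ∘ g) s)} := by
  intro γ f P hP
  refine (hT γ f _ ((hF.relabel (Sum.map (f ∘ g) id)).and hP)).of_iff fun M _ _ e => ?_
  simp [and_assoc, Sum.elim_comp_map, Function.comp_assoc]

/-- Evaluating a definable property at an updated assignment. -/
theorem _root_.FODef.update {P : ∀ (M : Type) [L.Structure M] [Nonempty M], (α ⊕ ℕ → M) → Prop}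
    (hP : FODef P) (v : ℕ) :
    FODef (L := L) (α := (α ⊕ ℕ) ⊕ Unit) fun M _ _ e =>
      P M (Sum.elim (e ∘ Sum.inl ∘ Sum.inl)
        (Function.update (e ∘ Sum.inl ∘ Sum.inr) v (e (Sum.inr ())))) := by
  refine (hP.relabel (Sum.elim (Sum.inl ∘ Sum.inl)
    (Function.update (Sum.inl ∘ Sum.inr) v (Sum.inr ())))).of_iff fun M _ _ e => ?_
  rw [Sum.comp_elim, Function.comp_update]

theorem update (hT : DefTeam T) (v : ℕ) :
    DefTeam (L := L) fun M _ _ e =>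
      {s' | ∃ s ∈ T M e, ∃ m : M, s' = Function.update s v m} := by
  intro γ f P hP
  refine (hT γ f _ (FODef.exists_elem (P := fun M _ _ e m =>
    P M (Sum.elim (e ∘ Sum.inl) (Function.update (e ∘ Sum.inr) v m)))
    (hP.update v))).of_iff fun M _ _ e => ?_
  constructor
  · rintro ⟨s, hs, m, h⟩
    exact ⟨_, ⟨s, hs, m, rfl⟩, h⟩
  · rintro ⟨_, ⟨s, hs, m, rfl⟩, h⟩
    exact ⟨s, hs, m, h⟩

theorem mem_teamMap (hT : DefTeam T) {k : ℕ} (xs : Fin k → ℕ) :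
    FODef (L := L) (α := α ⊕ Fin k) fun M _ _ e =>
      e ∘ Sum.inr ∈ teamMap (T M (e ∘ Sum.inl)) xs := by
  refine (hT (α ⊕ Fin k) Sum.inl (fun _ _ _ e => ∀ j, e (Sum.inl (Sum.inr j)) = e (Sum.inr (xs j)))
    (FODef.forall_finite fun j => FODef.var_eq _ _)).of_iff fun M _ _ e => ?_
  simp [teamMap, funext_iff]

theorem depAtom (hT : DefTeam T) {k : ℕ} {D : Dependency k} (hD : D.IsFirstOrder)
    (xs : Fin k → ℕ) : FODef (L := L) fun M _ _ e => D.Mem M (teamMap (T M e) xs) := by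
  obtain ⟨ψ, hψ⟩ := hD
  refine ((FODef.realize_relStructure (R := fun M _ _ e => teamMap (T M e) xs)
    (hT.mem_teamMap xs) ψ).relabel
    (Sum.elim id finZeroElim)).of_iff fun M _ _ e => ?_
  rw [hψ, Subsingleton.elim ((e ∘ Sum.elim id finZeroElim) ∘ Sum.inr) default]
  rfl

end DefTeam

/-- A team property that splits, relative to parameters `p : ℕ → M`, into a first-order condition
`flat` on each assignment and an upwards closed condition `cond` on the team, the latter being
first-order expressible on definable teams. -/
structure UpwardsNF (L : FirstOrder.Language.{0,0}) : Type 1 where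
  flat : ∀ (M : Type) [L.Structure M] [Nonempty M], (ℕ ⊕ ℕ → M) → Prop
  flat_def : FODef flat
  cond : ∀ (M : Type) [L.Structure M] [Nonempty M], (ℕ → M) → Set (ℕ → M) → Prop
  cond_mono : ∀ (M : Type) [L.Structure M] [Nonempty M] (p : ℕ → M) (X Y : Set (ℕ → M)),
    X ⊆ Y → cond M p X → cond M p Y
  cond_def : ∀ (α : Type) (g : ℕ → α)
    (T : ∀ (M : Type) [L.Structure M] [Nonempty M], (α → M) → Set (ℕ → M)), DefTeam T →
      FODef (L := L) fun M _ _ e => cond M (e ∘ g) (T M e)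

namespace UpwardsNF

def Sat (u : UpwardsNF L) (M : Type) [L.Structure M] [Nonempty M] (p : ℕ → M)
    (X : Set (ℕ → M)) : Prop :=
  (∀ s ∈ X, u.flat M (Sum.elim p s)) ∧ u.cond M p X

def reindex (u : UpwardsNF L) (f : ℕ → ℕ) : UpwardsNF L where
  flat M _ _ e := u.flat M (e ∘ Sum.map f id)
  flat_def := u.flat_def.relabel _
  cond M _ _ p X := u.cond M (p ∘ f) X
  cond_mono M _ _ p X Y := u.cond_mono M (p ∘ f) X Y
  cond_def α g T hT := u.cond_def α (g ∘ f) T hT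

theorem sat_reindex (u : UpwardsNF L) (f : ℕ → ℕ) (M : Type) [L.Structure M] [Nonempty M]
    (p : ℕ → M) (X : Set (ℕ → M)) : (u.reindex f).Sat M p X ↔ u.Sat M (p ∘ f) X := by
  simp [Sat, reindex, Sum.elim_comp_map]

def ofFlat (F : ∀ (M : Type) [L.Structure M] [Nonempty M], (ℕ ⊕ ℕ → M) → Prop)
    (hF : FODef F) : UpwardsNF L where
  flat := F
  flat_def := hF
  cond _ _ _ _ _ := True
  cond_mono _ _ _ _ _ _ _ h := h
  cond_def _ _ _ _ := FODef.true

def depAtom {k : ℕ} (D : Dependency k) (hup : D.UpwardsClosed) (hfo : D.IsFirstOrder)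
    (xs : Fin k → ℕ) : UpwardsNF L where
  flat _ _ _ _ := True
  flat_def := FODef.true
  cond M _ _ _ X := D.Mem M (teamMap X xs)
  cond_mono M _ _ _ X Y hXY h :=
    hup M _ _ h fun _ ⟨s, hs, ht⟩ => ⟨s, hXY hs, ht⟩
  cond_def _ _ _ hT := hT.depAtom hfo xs

def conj (u w : UpwardsNF L) : UpwardsNF L where
  flat M _ _ e := u.flat M e ∧ w.flat M e
  flat_def := u.flat_def.and w.flat_def
  cond M _ _ p X := u.cond M p X ∧ w.cond M p X
  cond_mono M _ _ p X Y hXY h := ⟨u.cond_mono M p X Y hXY h.1, w.cond_mono M p X Y hXY h.2⟩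
  cond_def α g T hT := (u.cond_def α g T hT).and (w.cond_def α g T hT)

theorem sat_conj (u w : UpwardsNF L) (M : Type) [L.Structure M] [Nonempty M] (p : ℕ → M)
    (X : Set (ℕ → M)) : (u.conj w).Sat M p X ↔ u.Sat M p X ∧ w.Sat M p X := by
  simp only [Sat, conj, forall₂_and]
  tauto

def disj (u w : UpwardsNF L) : UpwardsNF L where
  flat M _ _ e := u.flat M e ∨ w.flat M e
  flat_def := u.flat_def.or w.flat_def
  cond M _ _ p X := u.cond M p {s ∈ X | u.flat M (Sum.elim p s)} ∧
    w.cond M p {s ∈ X | w.flat M (Sum.elim p s)}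
  cond_mono M _ _ p X Y hXY h :=
    ⟨u.cond_mono M p _ _ (fun _ hs => ⟨hXY hs.1, hs.2⟩) h.1,
      w.cond_mono M p _ _ (fun _ hs => ⟨hXY hs.1, hs.2⟩) h.2⟩
  cond_def α g T hT :=
    (u.cond_def α g _ (hT.filter g u.flat_def)).and (w.cond_def α g _ (hT.filter g w.flat_def))

theorem sat_disj (u w : UpwardsNF L) (M : Type) [L.Structure M] [Nonempty M] (p : ℕ → M)
    (X : Set (ℕ → M)) :
    (u.disj w).Sat M p X ↔ ∃ Y Z, X = Y ∪ Z ∧ u.Sat M p Y ∧ w.Sat M p Z := by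
  constructor
  · rintro ⟨hflat, hu, hw⟩
    refine ⟨_, _, ?_, ⟨fun s hs => hs.2, hu⟩, ⟨fun s hs => hs.2, hw⟩⟩
    ext s
    constructor
    · exact fun hs => (hflat s hs).imp (fun h => ⟨hs, h⟩) (fun h => ⟨hs, h⟩)
    · rintro (hs | hs) <;> exact hs.1
  · rintro ⟨Y, Z, rfl, hu, hw⟩
    exact ⟨fun s hs => hs.imp (hu.1 s) (hw.1 s),
      u.cond_mono M p _ _ (fun s hs => ⟨Or.inl hs, hu.1 s hs⟩) hu.2,
      w.cond_mono M p _ _ (fun s hs => ⟨Or.inr hs, hw.1 s hs⟩) hw.2⟩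

def ex (v : ℕ) (u : UpwardsNF L) : UpwardsNF L where
  flat M _ _ e := ∃ m, u.flat M
    (Sum.elim (e ∘ Sum.inl) (Function.update (e ∘ Sum.inr) v m))
  flat_def := FODef.exists_elem (P := fun M _ _ e m => u.flat M
    (Sum.elim (e ∘ Sum.inl) (Function.update (e ∘ Sum.inr) v m))) (u.flat_def.update v)
  cond M _ _ p X := u.cond M p
    {s' ∈ {s' | ∃ s ∈ X, ∃ m : M, s' = Function.update s v m} | u.flat M (Sum.elim p s')}
  cond_mono M _ _ p X Y hXY h := by
    refine u.cond_mono M p _ _ ?_ h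
    rintro _ ⟨⟨s, hs, hm⟩, hf⟩
    exact ⟨⟨s, hXY hs, hm⟩, hf⟩
  cond_def α g T hT := u.cond_def α g _ ((hT.update v).filter g u.flat_def)

theorem sat_ex (v : ℕ) (u : UpwardsNF L) (M : Type) [L.Structure M] [Nonempty M] (p : ℕ → M)
    (X : Set (ℕ → M)) :
    (u.ex v).Sat M p X ↔ ∃ H : (ℕ → M) → Set M, (∀ s ∈ X, (H s).Nonempty) ∧
      u.Sat M p {s' | ∃ s ∈ X, ∃ m ∈ H s, s' = Function.update s v m} := by
  constructor
  · rintro ⟨hflat, hu⟩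
    refine ⟨fun s => {m | u.flat M (Sum.elim p (Function.update s v m))}, hflat, ?_, ?_⟩
    · rintro _ ⟨s, hs, m, hm, rfl⟩
      exact hm
    · refine u.cond_mono M p _ _ ?_ hu
      rintro _ ⟨⟨s, hs, m, rfl⟩, hm⟩
      exact ⟨s, hs, m, hm, rfl⟩
  · rintro ⟨H, hH, hflat, hu⟩
    refine ⟨fun s hs => ?_, u.cond_mono M p _ _ ?_ hu⟩
    · obtain ⟨m, hm⟩ := hH s hs
      exact ⟨m, hflat _ ⟨s, hs, m, hm, rfl⟩⟩
    · rintro s' hs'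
      refine ⟨?_, hflat s' hs'⟩
      obtain ⟨s, hs, m, -, rfl⟩ := hs'
      exact ⟨s, hs, m, rfl⟩

def fa (v : ℕ) (u : UpwardsNF L) : UpwardsNF L where
  flat M _ _ e := ∀ m, u.flat M
    (Sum.elim (e ∘ Sum.inl) (Function.update (e ∘ Sum.inr) v m))
  flat_def := FODef.forall_elem (P := fun M _ _ e m => u.flat M
    (Sum.elim (e ∘ Sum.inl) (Function.update (e ∘ Sum.inr) v m))) (u.flat_def.update v)
  cond M _ _ p X := u.cond M p {s' | ∃ s ∈ X, ∃ m : M, s' = Function.update s v m}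
  cond_mono M _ _ p X Y hXY h := by
    refine u.cond_mono M p _ _ ?_ h
    rintro _ ⟨s, hs, hm⟩
    exact ⟨s, hXY hs, hm⟩
  cond_def α g T hT := u.cond_def α g _ (hT.update v)

theorem sat_fa (v : ℕ) (u : UpwardsNF L) (M : Type) [L.Structure M] [Nonempty M] (p : ℕ → M)
    (X : Set (ℕ → M)) :
    (u.fa v).Sat M p X ↔ u.Sat M p {s' | ∃ s ∈ X, ∃ m : M, s' = Function.update s v m} := by
  refine and_congr_left fun _ => ⟨?_, fun h s hs m => h _ ⟨s, hs, m, rfl⟩⟩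
  rintro h _ ⟨s, hs, m, rfl⟩
  exact h s hs m

end UpwardsNF

/-- Two sequences of parameters can be coded by one. -/
theorem exists_interleave : ∃ f g : ℕ → ℕ, ∀ (M : Type) (p q : ℕ → M),
    ∃ r : ℕ → M, r ∘ f = p ∧ r ∘ g = q := by
  refine ⟨Equiv.natSumNatEquivNat ∘ Sum.inl, Equiv.natSumNatEquivNat ∘ Sum.inr,
    fun M p q => ⟨Sum.elim p q ∘ Equiv.natSumNatEquivNat.symm, ?_, ?_⟩⟩ <;> ext n <;> simp

/-- A list of normal forms represents a formula if satisfaction of the formula amounts to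
satisfaction of a member of the list for some choice of parameters. -/
def TSGFormula.RepresentedBy (φ : TSGFormula L) (l : List (UpwardsNF L)) : Prop :=
  ∀ (M : Type) [L.Structure M] [Nonempty M] (X : Set (ℕ → M)),
    φ.Sat M X ↔ ∃ p : ℕ → M, ∃ u ∈ l, u.Sat M p X

namespace TSGFormula.RepresentedBy

theorem ofFlat {φ : TSGFormula L} (θ : L.Formula ℕ)
    (h : ∀ (M : Type) [L.Structure M] [Nonempty M] (X : Set (ℕ → M)),
      φ.Sat M X ↔ ∀ s ∈ X, θ.Realize s) :
    ∃ l, φ.RepresentedBy l :=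
  ⟨[UpwardsNF.ofFlat _ (FODef.formula (θ.relabel Sum.inr))], fun M _ _ X => by
    simp [h, UpwardsNF.Sat, UpwardsNF.ofFlat]⟩

theorem constancy (n : ℕ) (xs : Fin n → ℕ) :
    ∃ l, (TSGFormula.constancy n xs : TSGFormula L).RepresentedBy l := by
  refine ⟨[UpwardsNF.ofFlat (fun M _ _ e => ∀ j : Fin n, e (Sum.inr (xs j)) = e (Sum.inl j))
    (FODef.forall_finite fun j => FODef.var_eq _ _)], fun M _ _ X => ?_⟩
  simp only [TSGFormula.Sat, List.mem_singleton, exists_eq_left, UpwardsNF.Sat, UpwardsNF.ofFlat,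
    and_true, Sum.elim_inr, Sum.elim_inl]
  constructor
  · intro h
    obtain rfl | ⟨s₀, h₀⟩ := X.eq_empty_or_nonempty
    · exact ⟨fun _ => Classical.arbitrary M, by simp⟩
    · refine ⟨fun i => if hi : i < n then s₀ (xs ⟨i, hi⟩) else s₀ 0, fun s hs j => ?_⟩
      simpa using h s hs s₀ h₀ j
  · rintro ⟨p, hp⟩ s hs s' hs' j
    rw [hp s hs, hp s' hs']

/-- Connectives that combine the satisfying teams of two formulas preserve representability. -/
theorem binary {φ ψ χ : TSGFormula L} (C : ∀ M : Type, Set (ℕ → M) → Set (ℕ → M) →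
      Set (ℕ → M) → Prop) (c : UpwardsNF L → UpwardsNF L → UpwardsNF L)
    (hχ : ∀ (M : Type) [L.Structure M] (X : Set (ℕ → M)),
      χ.Sat M X ↔ ∃ Y Z, C M X Y Z ∧ φ.Sat M Y ∧ ψ.Sat M Z)
    (hc : ∀ (u w : UpwardsNF L) (M : Type) [L.Structure M] [Nonempty M] (p : ℕ → M)
      (X : Set (ℕ → M)),
      (c u w).Sat M p X ↔ ∃ Y Z, C M X Y Z ∧ u.Sat M p Y ∧ w.Sat M p Z)
    (hφ : ∃ l, φ.RepresentedBy l) (hψ : ∃ l, ψ.RepresentedBy l) :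
    ∃ l, χ.RepresentedBy l := by
  obtain ⟨l, hl⟩ := hφ
  obtain ⟨l', hl'⟩ := hψ
  obtain ⟨f, g, hfg⟩ := exists_interleave
  refine ⟨(l.product l').map fun x => c (x.1.reindex f) (x.2.reindex g), fun M _ _ X => ?_⟩
  rw [hχ]
  constructor
  · rintro ⟨Y, Z, hC, hY, hZ⟩
    obtain ⟨p, u, hu, hY⟩ := (hl M Y).1 hY
    obtain ⟨q, w, hw, hZ⟩ := (hl' M Z).1 hZ
    obtain ⟨r, rfl, rfl⟩ := hfg M p q
    refine ⟨r, _, List.mem_map.2 ⟨(u, w), List.pair_mem_product.2 ⟨hu, hw⟩, rfl⟩, ?_⟩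
    exact (hc _ _ M r X).2 ⟨Y, Z, hC, (u.sat_reindex f M r Y).2 hY, (w.sat_reindex g M r Z).2 hZ⟩
  · rintro ⟨r, _, hx, h⟩
    obtain ⟨⟨u, w⟩, huw, rfl⟩ := List.mem_map.1 hx
    obtain ⟨hu, hw⟩ := List.pair_mem_product.1 huw
    obtain ⟨Y, Z, hC, hY, hZ⟩ := (hc _ _ M r X).1 h
    exact ⟨Y, Z, hC, (hl M Y).2 ⟨_, u, hu, (u.sat_reindex f M r Y).1 hY⟩,
      (hl' M Z).2 ⟨_, w, hw, (w.sat_reindex g M r Z).1 hZ⟩⟩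

/-- Connectives that transform the satisfying teams of a formula preserve representability. -/
theorem unary {φ χ : TSGFormula L} (C : ∀ M : Type, Set (ℕ → M) → Set (ℕ → M) → Prop)
    (c : UpwardsNF L → UpwardsNF L)
    (hχ : ∀ (M : Type) [L.Structure M] (X : Set (ℕ → M)),
      χ.Sat M X ↔ ∃ Y, C M X Y ∧ φ.Sat M Y)
    (hc : ∀ (u : UpwardsNF L) (M : Type) [L.Structure M] [Nonempty M] (p : ℕ → M)
      (X : Set (ℕ → M)), (c u).Sat M p X ↔ ∃ Y, C M X Y ∧ u.Sat M p Y)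
    (hφ : ∃ l, φ.RepresentedBy l) : ∃ l, χ.RepresentedBy l := by
  obtain ⟨l, hl⟩ := hφ
  refine ⟨l.map c, fun M _ _ X => ?_⟩
  rw [hχ]
  constructor
  · rintro ⟨Y, hC, hY⟩
    obtain ⟨p, u, hu, hY⟩ := (hl M Y).1 hY
    exact ⟨p, _, List.mem_map_of_mem hu, (hc u M p X).2 ⟨Y, hC, hY⟩⟩
  · rintro ⟨p, _, hx, h⟩
    obtain ⟨u, hu, rfl⟩ := List.mem_map.1 hx
    obtain ⟨Y, hC, hY⟩ := (hc u M p X).1 h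
    exact ⟨Y, hC, (hl M Y).2 ⟨p, u, hu, hY⟩⟩

theorem glob {φ ψ : TSGFormula L} (hφ : ∃ l, φ.RepresentedBy l)
    (hψ : ∃ l, ψ.RepresentedBy l) : ∃ l, (φ.glob ψ).RepresentedBy l := by
  obtain ⟨l, hl⟩ := hφ
  obtain ⟨l', hl'⟩ := hψ
  refine ⟨l ++ l', fun M _ _ X => ?_⟩
  simp only [TSGFormula.Sat, hl M X, hl' M X, List.mem_append, or_and_right, exists_or]

end TSGFormula.RepresentedBy

theorem TSGFormula.exists_representedBy (φ : TSGFormula L) : ∃ l, φ.RepresentedBy l := by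
  induction φ with
  | rel r ts => exact RepresentedBy.ofFlat (r.formula ts) fun M _ _ X => by simp [Sat]
  | nrel r ts => exact RepresentedBy.ofFlat (r.formula ts).not fun M _ _ X => by simp [Sat]
  | equal t₁ t₂ => exact RepresentedBy.ofFlat (t₁.equal t₂) fun M _ _ X => by simp [Sat]
  | nequal t₁ t₂ => exact RepresentedBy.ofFlat (t₁.equal t₂).not fun M _ _ X => by simp [Sat]
  | constancy n xs => exact RepresentedBy.constancy n xs
  | depAtom D hup hfo xs =>
    exact ⟨[.depAtom D hup hfo xs], fun M _ _ X => by simp [Sat, UpwardsNF.Sat, UpwardsNF.depAtom]⟩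
  | conj φ ψ hφ hψ =>
    exact RepresentedBy.binary (fun _ X Y Z => X = Y ∧ X = Z) .conj (fun M _ X => by simp [Sat])
      (fun u w M _ _ p X => by simp [UpwardsNF.sat_conj]) hφ hψ
  | disj φ ψ hφ hψ =>
    exact RepresentedBy.binary (fun _ X Y Z => X = Y ∪ Z) .disj (fun M _ X => Iff.rfl)
      UpwardsNF.sat_disj hφ hψ
  | glob φ ψ hφ hψ => exact RepresentedBy.glob hφ hψ
  | ex v φ hφ =>
    exact RepresentedBy.unary (fun M X Y => ∃ H : (ℕ → M) → Set M, (∀ s ∈ X, (H s).Nonempty) ∧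
      Y = {s' | ∃ s ∈ X, ∃ m ∈ H s, s' = Function.update s v m}) (.ex v)
      (fun M _ X => by simp only [Sat]; aesop)
      (fun u M _ _ p X => by rw [UpwardsNF.sat_ex]; aesop) hφ
  | fa v φ hφ =>
    exact RepresentedBy.unary
      (fun M X Y => Y = {s' | ∃ s ∈ X, ∃ m : M, s' = Function.update s v m}) (.fa v)
      (fun M _ X => by simp [Sat]) (fun u M _ _ p X => by simp [UpwardsNF.sat_fa]) hφ

/-- Every sentence of `FO(=(·), 𝒟↑, ⊔)` — first-order logic with team semantics augmented with
constancy atoms, all upwards closed first order dependencies, and global disjunctions — is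
equivalent to some first-order sentence. -/
theorem constancy_upwards_glob_stronglyFirstOrder (L : FirstOrder.Language.{0,0})
    (φ : TSGFormula L) (hφ : φ.freeVars = ∅) :
    ∃ ψ : L.Sentence, ∀ (M : Type) [L.Structure M] [Nonempty M],
      (φ.TrueIn M ↔ Sentence.Realize M ψ) := by
  obtain ⟨l, hl⟩ := φ.exists_representedBy
  have h : FODef (L := L) (α := ℕ ⊕ ℕ) fun M _ _ e =>
      ∃ u ∈ l, u.Sat M (e ∘ Sum.inr) {e ∘ Sum.inl} :=
    FODef.exists_mem_list l fun u =>
      ((u.flat_def.relabel Sum.swap).and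
        (u.cond_def _ Sum.inr _ (DefTeam.singleton Sum.inl))).of_iff fun M _ _ e => by
          simp only [UpwardsNF.Sat, Set.mem_singleton_iff, forall_eq]
          rw [show e ∘ Sum.swap = Sum.elim (e ∘ Sum.inr) (e ∘ Sum.inl) by
            ext (i | i) <;> rfl]
  obtain ⟨ψ, hψ⟩ := FODef.forall_fun (h.exists_fun.relabel (Sum.inr : ℕ → Empty ⊕ ℕ))
  refine ⟨ψ, fun M _ _ => ?_⟩
  rw [Sentence.Realize, hψ]
  simp only [TSGFormula.TrueIn, hl M, Sum.elim_comp_inl, Sum.elim_comp_inr]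
end

section
/- Every strongly first order dependency is first order: if D is a k-ary dependency such that every sentence of FO(D) is equivalent to some first-order sentence, then there exists a first-order sentence D(R) over the signature {R} such that (A, R) ∈ D iff (A, R) ⊨ D(R), for all models (A, R) with R a k-ary relation. -/
open FirstOrder FirstOrder.Language

/-- Formulas of `FO(𝒟)` in negation normal form, over the language `L`, with variables in `ℕ`,
where `𝒟` is the family of dependencies `(Ds i)_{i : ι}`. -/
inductive TSFormula (L : FirstOrder.Language.{0,0}) {ι : Type} (Ds : ι → (k : ℕ) × Dependency k) : Type
  | rel {n : ℕ} (r : L.Relations n) (ts : Fin n → L.Term ℕ)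
  | nrel {n : ℕ} (r : L.Relations n) (ts : Fin n → L.Term ℕ)
  | equal (t₁ t₂ : L.Term ℕ)
  | nequal (t₁ t₂ : L.Term ℕ)
  | depAtom (i : ι) (xs : Fin (Ds i).1 → ℕ)
  | conj (φ ψ : TSFormula L Ds)
  | disj (φ ψ : TSFormula L Ds)
  | ex (v : ℕ) (φ : TSFormula L Ds)
  | fa (v : ℕ) (φ : TSFormula L Ds)

variable {L : FirstOrder.Language.{0,0}} {ι : Type} {Ds : ι → (k : ℕ) × Dependency k}

/-- Team semantics for `FO(𝒟)`. -/
def TSFormula.Sat (M : Type) [L.Structure M] : TSFormula L Ds → Set (ℕ → M) → Prop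
  | .rel r ts, X => ∀ s ∈ X, Structure.RelMap r (fun i => (ts i).realize s)
  | .nrel r ts, X => ∀ s ∈ X, ¬ Structure.RelMap r (fun i => (ts i).realize s)
  | .equal t₁ t₂, X => ∀ s ∈ X, t₁.realize s = t₂.realize s
  | .nequal t₁ t₂, X => ∀ s ∈ X, t₁.realize s ≠ t₂.realize s
  | .depAtom i xs, X => (Ds i).2.Mem M (teamMap X xs)
  | .conj φ ψ, X => φ.Sat M X ∧ ψ.Sat M X
  | .disj φ ψ, X => ∃ Y Z : Set (ℕ → M), X = Y ∪ Z ∧ φ.Sat M Y ∧ ψ.Sat M Z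
  | .ex v φ, X => ∃ H : (ℕ → M) → Set M, (∀ s ∈ X, (H s).Nonempty) ∧
      φ.Sat M {s' | ∃ s ∈ X, ∃ m ∈ H s, s' = Function.update s v m}
  | .fa v φ, X => φ.Sat M {s' | ∃ s ∈ X, ∃ m : M, s' = Function.update s v m}

/-- The set of variables of a first-order term. -/
def termVars : L.Term ℕ → Set ℕ
  | .var x => {x}
  | .func _f ts => ⋃ i, termVars (ts i)

/-- The free variables of a team-semantics formula. -/
def TSFormula.freeVars : TSFormula L Ds → Set ℕ
  | .rel _ ts => ⋃ i, termVars (ts i)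
  | .nrel _ ts => ⋃ i, termVars (ts i)
  | .equal t₁ t₂ => termVars t₁ ∪ termVars t₂
  | .nequal t₁ t₂ => termVars t₁ ∪ termVars t₂
  | .depAtom _ xs => Set.range xs
  | .conj φ ψ => φ.freeVars ∪ ψ.freeVars
  | .disj φ ψ => φ.freeVars ∪ ψ.freeVars
  | .ex v φ => φ.freeVars \ {v}
  | .fa v φ => φ.freeVars \ {v}

/-- A sentence of `FO(𝒟)` is true in `M` iff it is satisfied by the team containing
only one assignment (for sentences, the choice of assignment is irrelevant). -/
def TSFormula.TrueIn (M : Type) [L.Structure M] (φ : TSFormula L Ds) : Prop :=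
  ∀ s : ℕ → M, φ.Sat M {s}

/-- A family of dependencies is strongly first order iff every sentence of `FO(𝒟)`,
over any (Type-0) signature, is equivalent to some first-order sentence. -/
def StronglyFirstOrderFamily {ι : Type} (Ds : ι → (k : ℕ) × Dependency k) : Prop :=
  ∀ (L : FirstOrder.Language.{0,0}) (φ : TSFormula L Ds), φ.freeVars = ∅ →
    ∃ ψ : L.Sentence, ∀ (M : Type) [L.Structure M] [Nonempty M],
      (φ.TrueIn M ↔ Sentence.Realize M ψ)

/-- A single dependency is strongly first order iff every sentence of `FO(D)`
is equivalent to some first-order sentence. -/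
def StronglyFirstOrder {k : ℕ} (D : Dependency k) : Prop :=
  StronglyFirstOrderFamily (fun _ : Unit => ⟨k, D⟩)

/-- Prefix `φ` with universal quantifiers over the variables `0, …, n - 1`. -/
def TSFormula.faPrefix : ℕ → TSFormula L Ds → TSFormula L Ds
  | 0, φ => φ
  | n + 1, φ => faPrefix n (.fa n φ)

theorem TSFormula.freeVars_faPrefix (n : ℕ) (φ : TSFormula L Ds) :
    (TSFormula.faPrefix n φ).freeVars = φ.freeVars \ Set.Iio n := by
  induction n generalizing φ with
  | zero => simp [TSFormula.faPrefix]
  | succ n ih =>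
    rw [TSFormula.faPrefix, ih, TSFormula.freeVars]
    ext x
    simp only [Set.mem_sdiff, Set.mem_singleton_iff, Set.mem_Iio]
    grind

theorem TSFormula.sat_faPrefix (M : Type) [L.Structure M] (n : ℕ) (φ : TSFormula L Ds)
    (X : Set (ℕ → M)) :
    (TSFormula.faPrefix n φ).Sat M X ↔ φ.Sat M {s' | ∃ s ∈ X, ∀ i, n ≤ i → s' i = s i} := by
  induction n generalizing φ with
  | zero =>
    have hX : {s' : ℕ → M | ∃ s ∈ X, ∀ i, 0 ≤ i → s' i = s i} = X := by
      ext s'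
      refine ⟨?_, fun hs => ⟨s', hs, fun _ _ => rfl⟩⟩
      rintro ⟨s, hs, he⟩
      rwa [funext fun i => he i i.zero_le]
    rw [TSFormula.faPrefix, hX]
  | succ n ih =>
    rw [TSFormula.faPrefix, ih, TSFormula.Sat]
    refine iff_of_eq (congrArg _ ?_)
    ext s'
    constructor
    · rintro ⟨t, ⟨s, hs, hts⟩, m, rfl⟩
      refine ⟨s, hs, fun i hi => ?_⟩
      rw [Function.update_of_ne (by omega)]
      exact hts i (by omega)
    · rintro ⟨s, hs, he⟩
      refine ⟨Function.update s' n (s n), ⟨s, hs, fun i hi => ?_⟩, s' n, by simp⟩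
      rcases eq_or_lt_of_le hi with rfl | hlt
      · simp
      · rw [Function.update_of_ne (by omega)]
        exact he i hlt

/-- The `FO(D)` sentence `∀ x⃗ (¬ R x⃗ ∨ (R x⃗ ∧ D x⃗))`, which asserts that `R` satisfies `D`. -/
def Dependency.sentence {k : ℕ} (D : Dependency k) :
    TSFormula (relLang k) (fun _ : Unit => (⟨k, D⟩ : (k : ℕ) × Dependency k)) :=
  TSFormula.faPrefix k
    (.disj (.nrel (PLift.up rfl : (relLang k).Relations k) fun i => Term.var i)
      (.conj (.rel (PLift.up rfl : (relLang k).Relations k) fun i => Term.var i)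
        (.depAtom () fun i : Fin k => (i : ℕ))))

theorem Dependency.freeVars_sentence {k : ℕ} (D : Dependency k) : D.sentence.freeVars = ∅ := by
  rw [Dependency.sentence, TSFormula.freeVars_faPrefix]
  ext x
  simp only [TSFormula.freeVars, termVars, Set.mem_sdiff, Set.mem_union, Set.mem_iUnion,
    Set.mem_singleton_iff, Set.mem_range, Set.mem_Iio, Set.mem_empty_iff_false, iff_false]
  rintro ⟨⟨i, rfl⟩ | ⟨i, rfl⟩ | ⟨i, rfl⟩, hx⟩ <;> exact hx i.isLt

theorem Dependency.sat_sentence {k : ℕ} (D : Dependency k) (A : Type) (R : Set (Fin k → A))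
    (s : ℕ → A) :
    letI := relStructure A R
    D.sentence.Sat A {s} ↔ D.Mem A R := by
  let _ := relStructure A R
  change D.sentence.Sat A {s} ↔ _
  rw [Dependency.sentence, TSFormula.sat_faPrefix]
  set X : Set (ℕ → A) := {s' | ∃ t ∈ ({s} : Set (ℕ → A)), ∀ i, k ≤ i → s' i = t i} with hX
  have hmap : teamMap {t ∈ X | (fun i : Fin k => t i) ∈ R} (fun i : Fin k => (i : ℕ)) = R := by
    ext u
    constructor
    · rintro ⟨t, ht, rfl⟩
      exact ht.2
    · intro hu
      have he : (fun i : Fin k => if h : (i : ℕ) < k then u ⟨i, h⟩ else s i) = u := by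
        funext i
        simp
      refine ⟨fun i => if h : i < k then u ⟨i, h⟩ else s i, ⟨⟨s, rfl, fun i hi => ?_⟩, ?_⟩, he.symm⟩
      · simp [Nat.not_lt.mpr hi]
      · exact Set.mem_of_eq_of_mem he hu
  constructor
  · rintro ⟨Y, Z, hYZ, hY, hZ, hD⟩
    have hZ' : Z = {t ∈ X | (fun i : Fin k => t i) ∈ R} := by
      ext t
      refine ⟨fun ht => ⟨hYZ ▸ Or.inr ht, hZ t ht⟩, ?_⟩
      rintro ⟨ht, htR⟩
      rw [hYZ] at ht
      exact ht.resolve_left fun h => hY t h htR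
    have hmem : D.Mem A (teamMap Z fun i : Fin k => (i : ℕ)) := hD
    rwa [hZ', hmap] at hmem
  · intro hD
    refine ⟨{t ∈ X | (fun i : Fin k => t i) ∉ R}, {t ∈ X | (fun i : Fin k => t i) ∈ R}, ?_,
      fun t ht => ht.2, fun t ht => ht.2, ?_⟩
    · ext t
      simp only [Set.mem_union, Set.mem_ofPred_eq]
      tauto
    · change D.Mem A _
      rwa [hmap]

/-- Every strongly first order dependency is first order: if every sentence of `FO(D)` is
equivalent to a first-order sentence, then `D` is definable by a first-order sentence
over the signature `{R}`. -/
theorem stronglyFirstOrder_isFirstOrder {k : ℕ} (D : Dependency k)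
    (h : StronglyFirstOrder D) : D.IsFirstOrder := by
  obtain ⟨ψ, hψ⟩ := h (relLang k) D.sentence D.freeVars_sentence
  refine ⟨ψ, fun A hA R => ?_⟩
  let _ := relStructure A R
  refine Iff.trans ?_ (hψ A)
  exact ⟨fun hD s => (D.sat_sentence A R s).mpr hD,
    fun hs => (D.sat_sentence A R _).mp (hs fun _ => hA.some)⟩
end

section
/- Let 𝒟 be a family of union closed dependencies. Then every formula φ of FO(𝒟) is union closed: for every model M and every family (X_i)_{i∈I} of teams over M with the same domain containing the free variables of φ (I possibly empty), if M ⊨_{X_i} φ for all i ∈ I then M ⊨_{⋃_{i∈I} X_i} φ. -/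
open FirstOrder FirstOrder.Language

variable {L : FirstOrder.Language.{0,0}} {ι : Type} {Ds : ι → (k : ℕ) × Dependency k}

/-- If every dependency in the family `𝒟` is union closed, then every formula of `FO(𝒟)` is
union closed: if it is satisfied by every team of a (possibly empty) family `(X_i)_{i ∈ I}`,
it is satisfied by their union. -/
theorem unionClosed_sat {ι : Type} (Ds : ι → (k : ℕ) × Dependency k)
    (h : ∀ i, (Ds i).2.UnionClosed) :
    ∀ (L : FirstOrder.Language.{0,0}) (M : Type) [L.Structure M] (φ : TSFormula L Ds)
      (I : Type) (X : I → Set (ℕ → M)),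
      (∀ i, φ.Sat M (X i)) → φ.Sat M (⋃ i, X i) := by
  intro L M _ φ
  induction φ with
  | rel r ts => exact fun I X hX s hs => let ⟨i, hi⟩ := Set.mem_iUnion.1 hs; hX i s hi
  | nrel r ts => exact fun I X hX s hs => let ⟨i, hi⟩ := Set.mem_iUnion.1 hs; hX i s hi
  | equal t₁ t₂ => exact fun I X hX s hs => let ⟨i, hi⟩ := Set.mem_iUnion.1 hs; hX i s hi
  | nequal t₁ t₂ => exact fun I X hX s hs => let ⟨i, hi⟩ := Set.mem_iUnion.1 hs; hX i s hi
  | depAtom j xs =>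
    intro I X hX
    have key : teamMap (⋃ i, X i) xs = ⋃ i, teamMap (X i) xs := by
      ext t
      simp only [teamMap, Set.mem_iUnion, Set.mem_ofPred_eq]
      grind
    change (Ds j).2.Mem M (teamMap (⋃ i, X i) xs)
    rw [key]
    exact h j M I _ hX
  | conj φ ψ ihφ ihψ =>
    exact fun I X hX => ⟨ihφ I X fun i => (hX i).1, ihψ I X fun i => (hX i).2⟩
  | disj φ ψ ihφ ihψ =>
    intro I X hX
    choose Y Z hYZ hY hZ using hX
    exact ⟨⋃ i, Y i, ⋃ i, Z i, by simp only [hYZ, Set.iUnion_union_distrib], ihφ I Y hY, ihψ I Z hZ⟩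
  | ex v φ ih =>
    intro I X hX
    choose H hne hH using hX
    refine ⟨fun s => {m | ∃ i, s ∈ X i ∧ m ∈ H i s}, fun s hs => ?_, ?_⟩
    · obtain ⟨i, hi⟩ := Set.mem_iUnion.1 hs
      obtain ⟨m, hm⟩ := hne i s hi
      exact ⟨m, i, hi, hm⟩
    · convert ih I _ hH using 1
      ext s'
      simp only [Set.mem_iUnion, Set.mem_ofPred_eq]
      grind
  | fa v φ ih =>
    intro I X hX
    change φ.Sat M _
    convert ih I _ hX using 1
    ext s'
    simp only [Set.mem_iUnion, Set.mem_ofPred_eq]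
    grind
end

section
/- If a dependency D is domain independent, then it is relativizable. Moreover, for all models M whose signature contains the unary predicate P and all teams X over M whose domain contains x⃗, M ⊨_X D^(P) x⃗ if and only if M ⊨_X D x⃗ ∧ ⋀_{x∈x⃗} P x; consequently every sentence of FO(D^(P)) is equivalent to the FO(D) sentence obtained by replacing each atom D^(P) x⃗ with D x⃗ ∧ ⋀_{x∈x⃗} P x. -/
open FirstOrder FirstOrder.Language

variable {L : FirstOrder.Language.{0,0}} {ι : Type} {Ds : ι → (k : ℕ) × Dependency k}

variable {k : ℕ} {D : Dependency k}

/-- The relation `T` on `M` viewed as a relation on the subset `PM` (keeping the tuples all of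
whose components lie in `PM`). -/
def relTeam {M : Type} (PM : Set M) {n : ℕ} (T : Set (Fin n → M)) : Set (Fin n → PM) :=
  {t | (fun i => (t i : M)) ∈ T}

/-- Team semantics for `FO(D^(P))`: as for `FO(D)`, except that the dependency atom `D^(P) x⃗`
holds in `X` iff `(P^M, X(x⃗)) ∈ D` (in particular `X(x⃗) ⊆ (P^M)^k`). -/
def TSFormula.SatP {L : FirstOrder.Language.{0,0}} (p : L.Relations 1) (M : Type)
    [L.Structure M] : TSFormula L (fun _ : Unit => ⟨k, D⟩) → Set (ℕ → M) → Prop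
  | .rel r ts, X => ∀ s ∈ X, Structure.RelMap r (fun i => (ts i).realize s)
  | .nrel r ts, X => ∀ s ∈ X, ¬ Structure.RelMap r (fun i => (ts i).realize s)
  | .equal t₁ t₂, X => ∀ s ∈ X, t₁.realize s = t₂.realize s
  | .nequal t₁ t₂, X => ∀ s ∈ X, t₁.realize s ≠ t₂.realize s
  | .depAtom _ xs, X =>
      (∀ t ∈ teamMap X xs, ∀ j, Structure.RelMap p (fun _ : Fin 1 => t j)) ∧
      D.Mem {a : M | Structure.RelMap p (fun _ : Fin 1 => a)}
        (relTeam {a : M | Structure.RelMap p (fun _ : Fin 1 => a)} (teamMap X xs))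
  | .conj φ ψ, X => φ.SatP p M X ∧ ψ.SatP p M X
  | .disj φ ψ, X => ∃ Y Z : Set (ℕ → M), X = Y ∪ Z ∧ φ.SatP p M Y ∧ ψ.SatP p M Z
  | .ex v φ, X => ∃ H : (ℕ → M) → Set M, (∀ s ∈ X, (H s).Nonempty) ∧
      φ.SatP p M {s' | ∃ s ∈ X, ∃ m ∈ H s, s' = Function.update s v m}
  | .fa v φ, X => φ.SatP p M {s' | ∃ s ∈ X, ∃ m : M, s' = Function.update s v m}

/-- Truth of a sentence of `FO(D^(P))` in a model. -/
def TSFormula.TrueInP {L : FirstOrder.Language.{0,0}} (p : L.Relations 1) (M : Type)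
    [L.Structure M] (φ : TSFormula L (fun _ : Unit => ⟨k, D⟩)) : Prop :=
  ∀ s : ℕ → M, φ.SatP p M {s}

/-- Finite conjunction of team-semantics formulas (`⊤` for the empty list). -/
def conjListTS {L : FirstOrder.Language.{0,0}} {ι : Type} {Ds : ι → (k : ℕ) × Dependency k} :
    List (TSFormula L Ds) → TSFormula L Ds
  | [] => .equal (Term.var 0) (Term.var 0)
  | φ :: l => .conj φ (conjListTS l)

/-- The translation from `FO(D^(P))` to `FO(D)`: replace each relativized atom `D^(P) x⃗`
with `D x⃗ ∧ ⋀_{x ∈ x⃗} P x`. -/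
def relativize {L : FirstOrder.Language.{0,0}} (p : L.Relations 1) :
    TSFormula L (fun _ : Unit => ⟨k, D⟩) → TSFormula L (fun _ : Unit => ⟨k, D⟩)
  | .rel r ts => .rel r ts
  | .nrel r ts => .nrel r ts
  | .equal t₁ t₂ => .equal t₁ t₂
  | .nequal t₁ t₂ => .nequal t₁ t₂
  | .depAtom i xs => .conj (.depAtom i xs)
      (conjListTS (List.ofFn fun j : Fin k => .rel p (fun _ : Fin 1 => Term.var (xs j))))
  | .conj φ ψ => .conj (relativize p φ) (relativize p ψ)
  | .disj φ ψ => .disj (relativize p φ) (relativize p ψ)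
  | .ex v φ => .ex v (relativize p φ)
  | .fa v φ => .fa v (relativize p φ)

/-- `D` is relativizable: every sentence of `FO(D^(P))` is equivalent to some sentence
of `FO(D)`. -/
def Relativizable {k : ℕ} (D : Dependency k) : Prop :=
  ∀ (L : FirstOrder.Language.{0,0}) (p : L.Relations 1)
    (φ : TSFormula L (fun _ : Unit => ⟨k, D⟩)), φ.freeVars = ∅ →
    ∃ φ' : TSFormula L (fun _ : Unit => ⟨k, D⟩), φ'.freeVars = ∅ ∧
      ∀ (M : Type) [L.Structure M] [Nonempty M], φ.TrueInP p M ↔ φ'.TrueIn M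

/-- Membership in a dependency is invariant under bijections. -/
theorem Dependency.mem_iff_of_equiv {k : ℕ} (D : Dependency k) {A B : Type} (e : A ≃ B)
    {R : Set (Fin k → A)} {S : Set (Fin k → B)}
    (h : ∀ t : Fin k → A, t ∈ R ↔ (fun i => e (t i)) ∈ S) : D.Mem A R ↔ D.Mem B S := by
  have hS : (fun (t : Fin k → A) (i : Fin k) => e (t i)) '' R = S := by
    ext u
    constructor
    · rintro ⟨t, ht, rfl⟩
      exact (h t).1 ht
    · intro hu
      exact ⟨fun i => e.symm (u i), (h _).2 (by simpa using hu), by simp⟩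
  have hR : (fun (t : Fin k → B) (i : Fin k) => e.symm (t i)) '' S = R := by
    rw [← hS, Set.image_image]
    simp
  exact ⟨fun hm => hS ▸ D.iso_closed e R hm, fun hm => hR ▸ D.iso_closed e.symm S hm⟩

/-- A domain independent dependency does not distinguish a relation on `M` from its copy on a
subset of `M` that contains all the entries of the relation. -/
theorem Dependency.DomainIndependent.mem_relTeam_iff {k : ℕ} {D : Dependency k}
    (hdi : D.DomainIndependent) {M : Type} {Q : Set M} {T : Set (Fin k → M)}
    (hT : ∀ t ∈ T, ∀ j, t j ∈ Q) : D.Mem Q (relTeam Q T) ↔ D.Mem M T := by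
  rw [hdi Q, hdi M T]
  have hFld : ∀ a : Q, a ∈ Fld (relTeam Q T) ↔ (a : M) ∈ Fld T := by
    intro a
    constructor
    · rintro ⟨t, ht, i, rfl⟩
      exact ⟨_, ht, i, rfl⟩
    · rintro ⟨t, ht, i, hi⟩
      exact ⟨fun j => ⟨t j, hT t ht j⟩, ht, i, Subtype.ext hi⟩
  have hQ : ∀ a ∈ Fld T, a ∈ Q := by
    rintro _ ⟨t, ht, i, rfl⟩
    exact hT t ht i
  let e : Fld (relTeam Q T) ≃ Fld T :=
    { toFun := fun a => ⟨a.1.1, (hFld a.1).1 a.2⟩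
      invFun := fun a => ⟨⟨a.1, hQ a.1 a.2⟩, (hFld _).2 a.2⟩
      left_inv := fun _ => rfl
      right_inv := fun _ => rfl }
  exact D.mem_iff_of_equiv e fun _ => Iff.rfl

theorem sat_conjListTS {L : FirstOrder.Language.{0,0}} {ι : Type}
    {Ds : ι → (k : ℕ) × Dependency k} (M : Type) [L.Structure M] (X : Set (ℕ → M))
    (l : List (TSFormula L Ds)) : (conjListTS l).Sat M X ↔ ∀ ψ ∈ l, ψ.Sat M X := by
  induction l with
  | nil => simp [conjListTS, TSFormula.Sat]
  | cons ψ l ih => simp [conjListTS, TSFormula.Sat, ih]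

theorem sat_foldr_conj {L : FirstOrder.Language.{0,0}} {ι : Type}
    {Ds : ι → (k : ℕ) × Dependency k} (M : Type) [L.Structure M] (X : Set (ℕ → M))
    (χ : TSFormula L Ds) (l : List (TSFormula L Ds)) :
    (l.foldr .conj χ).Sat M X ↔ χ.Sat M X ∧ ∀ ψ ∈ l, ψ.Sat M X := by
  induction l with
  | nil => simp
  | cons ψ l ih =>
    simp only [List.foldr_cons, TSFormula.Sat, ih, List.forall_mem_cons]
    tauto

theorem freeVars_foldr_conj_subset {L : FirstOrder.Language.{0,0}} {ι : Type}
    {Ds : ι → (k : ℕ) × Dependency k} {V : Set ℕ} {χ : TSFormula L Ds}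
    (hχ : χ.freeVars ⊆ V) (l : List (TSFormula L Ds)) (hl : ∀ ψ ∈ l, ψ.freeVars ⊆ V) :
    (l.foldr .conj χ).freeVars ⊆ V := by
  induction l with
  | nil => exact hχ
  | cons ψ l ih =>
    rw [List.forall_mem_cons] at hl
    exact Set.union_subset hl.1 (ih hl.2)

/-- The atoms `P x` for `x` in the tuple `xs`. -/
def predAtoms {L : FirstOrder.Language.{0,0}} {ι : Type} {Ds : ι → (k : ℕ) × Dependency k}
    (p : L.Relations 1) {k : ℕ} (xs : Fin k → ℕ) : List (TSFormula L Ds) :=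
  List.ofFn fun j : Fin k => .rel p (fun _ : Fin 1 => Term.var (xs j))

theorem sat_predAtoms {L : FirstOrder.Language.{0,0}} {ι : Type}
    {Ds : ι → (k : ℕ) × Dependency k} (p : L.Relations 1) (M : Type) [L.Structure M]
    {k : ℕ} (xs : Fin k → ℕ) (X : Set (ℕ → M)) :
    (∀ ψ ∈ predAtoms (Ds := Ds) p xs, ψ.Sat M X) ↔
      ∀ t ∈ teamMap X xs, ∀ j, Structure.RelMap p (fun _ : Fin 1 => t j) := by
  rw [predAtoms, List.forall_mem_ofFn_iff]
  constructor
  · rintro h _ ⟨s, hs, rfl⟩ j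
    exact h j s hs
  · intro h j s hs
    exact h _ ⟨s, hs, rfl⟩ j

theorem satP_depAtom_iff {k : ℕ} {D : Dependency k} (hdi : D.DomainIndependent)
    {L : FirstOrder.Language.{0,0}} (p : L.Relations 1) (M : Type) [L.Structure M]
    (u : Unit) (xs : Fin k → ℕ) (X : Set (ℕ → M)) :
    TSFormula.SatP (D := D) p M (.depAtom u xs) X ↔
      D.Mem M (teamMap X xs) ∧
        ∀ t ∈ teamMap X xs, ∀ j, Structure.RelMap p (fun _ : Fin 1 => t j) := by
  rw [and_comm]
  exact and_congr_right fun h => hdi.mem_relTeam_iff h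

theorem satP_depAtom_iff_sat_relativize {k : ℕ} {D : Dependency k} (hdi : D.DomainIndependent)
    {L : FirstOrder.Language.{0,0}} (p : L.Relations 1) (M : Type) [L.Structure M]
    (u : Unit) (xs : Fin k → ℕ) (X : Set (ℕ → M)) :
    TSFormula.SatP (D := D) p M (.depAtom u xs) X ↔
      (relativize (D := D) p (.depAtom u xs)).Sat M X := by
  rw [satP_depAtom_iff hdi, ← sat_predAtoms (Ds := fun _ : Unit => ⟨k, D⟩), ← sat_conjListTS]
  rfl

/-- A variant of `relativize` that introduces no new free variables (`conjListTS` ends in the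
formula `x₀ = x₀`). -/
def relativizeClosed {k : ℕ} {D : Dependency k} {L : FirstOrder.Language.{0,0}}
    (p : L.Relations 1) :
    TSFormula L (fun _ : Unit => ⟨k, D⟩) → TSFormula L (fun _ : Unit => ⟨k, D⟩)
  | .rel r ts => .rel r ts
  | .nrel r ts => .nrel r ts
  | .equal t₁ t₂ => .equal t₁ t₂
  | .nequal t₁ t₂ => .nequal t₁ t₂
  | .depAtom i xs => (predAtoms p xs).foldr .conj (.depAtom i xs)
  | .conj φ ψ => .conj (relativizeClosed p φ) (relativizeClosed p ψ)
  | .disj φ ψ => .disj (relativizeClosed p φ) (relativizeClosed p ψ)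
  | .ex v φ => .ex v (relativizeClosed p φ)
  | .fa v φ => .fa v (relativizeClosed p φ)

theorem freeVars_relativizeClosed_subset {k : ℕ} {D : Dependency k}
    {L : FirstOrder.Language.{0,0}} (p : L.Relations 1)
    (φ : TSFormula L (fun _ : Unit => ⟨k, D⟩)) :
    (relativizeClosed p φ).freeVars ⊆ φ.freeVars := by
  induction φ with
  | rel | nrel | equal | nequal => exact subset_rfl
  | depAtom i xs =>
    refine freeVars_foldr_conj_subset subset_rfl _ ?_
    rw [predAtoms, List.forall_mem_ofFn_iff]
    intro j
    refine Set.iUnion_subset fun _ => ?_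
    rintro _ rfl
    exact ⟨j, rfl⟩
  | conj φ ψ ih₁ ih₂ => exact Set.union_subset_union ih₁ ih₂
  | disj φ ψ ih₁ ih₂ => exact Set.union_subset_union ih₁ ih₂
  | ex v φ ih => exact Set.sdiff_subset_sdiff_left ih
  | fa v φ ih => exact Set.sdiff_subset_sdiff_left ih

theorem satP_iff_sat_relativize {k : ℕ} {D : Dependency k} (hdi : D.DomainIndependent)
    {L : FirstOrder.Language.{0,0}} (p : L.Relations 1) (M : Type) [L.Structure M]
    (φ : TSFormula L (fun _ : Unit => ⟨k, D⟩)) (X : Set (ℕ → M)) :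
    φ.SatP p M X ↔ (relativize p φ).Sat M X := by
  induction φ generalizing X with
  | rel | nrel | equal | nequal => exact Iff.rfl
  | depAtom i xs => exact satP_depAtom_iff_sat_relativize hdi p M i xs X
  | conj | disj | ex | fa => simp only [TSFormula.SatP, relativize, TSFormula.Sat, *]

theorem satP_iff_sat_relativizeClosed {k : ℕ} {D : Dependency k} (hdi : D.DomainIndependent)
    {L : FirstOrder.Language.{0,0}} (p : L.Relations 1) (M : Type) [L.Structure M]
    (φ : TSFormula L (fun _ : Unit => ⟨k, D⟩)) (X : Set (ℕ → M)) :
    φ.SatP p M X ↔ (relativizeClosed p φ).Sat M X := by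
  induction φ generalizing X with
  | rel | nrel | equal | nequal => exact Iff.rfl
  | depAtom i xs =>
    exact (satP_depAtom_iff hdi p M i xs X).trans
      ((and_congr_right' (sat_predAtoms p M xs X).symm).trans
        (sat_foldr_conj (Ds := fun _ : Unit => ⟨k, D⟩) M X (.depAtom i xs)
          (predAtoms p xs)).symm)
  | conj | disj | ex | fa => simp only [TSFormula.SatP, relativizeClosed, TSFormula.Sat, *]

/-- If a dependency `D` is domain independent, then: (1) for all models `M` and teams `X`,
`M ⊨_X D^(P) x⃗` iff `M ⊨_X D x⃗ ∧ ⋀_{x ∈ x⃗} P x`; (2) consequently every sentence of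
`FO(D^(P))` is equivalent to the `FO(D)` sentence obtained by replacing each atom `D^(P) x⃗`
with `D x⃗ ∧ ⋀_{x ∈ x⃗} P x`; and (3) `D` is relativizable. -/
theorem domainIndependent_relativizable {k : ℕ} (D : Dependency k)
    (hdi : D.DomainIndependent) :
    (∀ (L : FirstOrder.Language.{0,0}) (p : L.Relations 1) (M : Type) [L.Structure M]
      (xs : Fin k → ℕ) (X : Set (ℕ → M)),
        TSFormula.SatP (D := D) p M
            (TSFormula.depAtom (Ds := fun _ : Unit => ⟨k, D⟩) () xs) X ↔
          TSFormula.Sat M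
            (relativize (D := D) p
              (TSFormula.depAtom (Ds := fun _ : Unit => ⟨k, D⟩) () xs)) X) ∧
    (∀ (L : FirstOrder.Language.{0,0}) (p : L.Relations 1)
      (φ : TSFormula L (fun _ : Unit => ⟨k, D⟩)), φ.freeVars = ∅ →
        ∀ (M : Type) [L.Structure M] [Nonempty M],
          φ.TrueInP p M ↔ (relativize p φ).TrueIn M) ∧
    Relativizable D := by
  refine ⟨fun L p M _ xs X => satP_depAtom_iff_sat_relativize hdi p M () xs X,
    fun L p φ _ M _ _ => forall_congr' fun s => satP_iff_sat_relativize hdi p M φ {s},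
    fun L p φ hφ => ⟨relativizeClosed p φ, ?_, fun M _ _ =>
      forall_congr' fun s => satP_iff_sat_relativizeClosed hdi p M φ {s}⟩⟩
  exact Set.subset_empty_iff.1 (hφ ▸ freeVars_relativizeClosed_subset p φ)
end

section
/- If a dependency D is downwards closed and strongly first order, then D is non-jumping: whenever (M, R) ∈ D, there exists some R' ⊇ R such that (M, R') ∈ D_max and (M, S) ∈ D for all relations S with R ⊆ S ⊆ R'. -/
open FirstOrder FirstOrder.Language

variable {L : FirstOrder.Language.{0,0}} {ι : Type} {Ds : ι → (k : ℕ) × Dependency k}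

/-- `(M, R) ∈ D_max` iff `(M, R) ∈ D` and no proper superset of `R` is in `D` over `M`. -/
def Dependency.MaxAt {k : ℕ} (D : Dependency k) (M : Type) (R : Set (Fin k → M)) : Prop :=
  D.Mem M R ∧ ¬ ∃ S : Set (Fin k → M), R ⊂ S ∧ D.Mem M S


namespace NonJumping

/-- The trees recording the behaviour of an `n`-tuple in a structure with one `k`-ary relation up to
quantifier rank `r`. -/
def RankType (k : ℕ) : ℕ → ℕ → Type
  | 0, n => (Fin n → Fin n → Prop) × ((Fin k → Fin n) → Prop)
  | r + 1, n => Set (RankType k r (n + 1))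

instance RankType.finite (k : ℕ) : ∀ r n, Finite (RankType k r n)
  | 0, n => by unfold RankType; infer_instance
  | r + 1, n => by
    have := RankType.finite k r (n + 1)
    unfold RankType
    infer_instance

/-- The quantifier rank `r` type of the tuple `a` in the structure `(M, X)`. -/
def rankType {k : ℕ} {M : Type} (X : Set (Fin k → M)) :
    (r : ℕ) → {n : ℕ} → (Fin n → M) → RankType k r n
  | 0, _, a => (fun i j => a i = a j, fun w => a ∘ w ∈ X)
  | r + 1, n, a =>
    Set.range fun x : M => rankType X r (Fin.snoc a x : Fin (n + 1) → M)

/-- The relation "every formula of rank `r` positive in the relation symbol that holds on the left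
holds on the right", expressed through types. -/
def RankType.Le {k : ℕ} : (r : ℕ) → {n : ℕ} → RankType k r n → RankType k r n → Prop
  | 0, _, σ, τ => σ.1 = τ.1 ∧ ∀ w, σ.2 w → τ.2 w
  | r + 1, n, σ, τ =>
    (∀ σ' : RankType k r (n + 1), (show Set _ from σ) σ' →
      ∃ τ' : RankType k r (n + 1), (show Set _ from τ) τ' ∧ RankType.Le r σ' τ') ∧
    ∀ τ' : RankType k r (n + 1), (show Set _ from τ) τ' →
      ∃ σ' : RankType k r (n + 1), (show Set _ from σ) σ' ∧ RankType.Le r σ' τ'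

variable {k : ℕ} {M N : Type}

theorem le_rankType_zero {X : Set (Fin k → M)} {Y : Set (Fin k → N)} {n : ℕ}
    {a : Fin n → M} {b : Fin n → N} :
    RankType.Le 0 (rankType X 0 a) (rankType Y 0 b) ↔
      (∀ i j, a i = a j ↔ b i = b j) ∧ ∀ w : Fin k → Fin n, a ∘ w ∈ X → b ∘ w ∈ Y := by
  simp only [RankType.Le, rankType, funext_iff, eq_iff_iff]

theorem le_rankType_succ {X : Set (Fin k → M)} {Y : Set (Fin k → N)} {r n : ℕ}
    {a : Fin n → M} {b : Fin n → N} :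
    RankType.Le (r + 1) (rankType X (r + 1) a) (rankType Y (r + 1) b) ↔
      (∀ x, ∃ y, RankType.Le r (rankType X r (Fin.snoc a x : Fin (n + 1) → M))
        (rankType Y r (Fin.snoc b y : Fin (n + 1) → N))) ∧
      ∀ y, ∃ x, RankType.Le r (rankType X r (Fin.snoc a x : Fin (n + 1) → M))
        (rankType Y r (Fin.snoc b y : Fin (n + 1) → N)) := by
  constructor
  · rintro ⟨h₁, h₂⟩
    refine ⟨fun x => ?_, fun y => ?_⟩
    · obtain ⟨_, ⟨y, rfl⟩, h⟩ := h₁ _ ⟨x, rfl⟩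
      exact ⟨y, h⟩
    · obtain ⟨_, ⟨x, rfl⟩, h⟩ := h₂ _ ⟨y, rfl⟩
      exact ⟨x, h⟩
  · rintro ⟨h₁, h₂⟩
    refine ⟨?_, ?_⟩
    · rintro _ ⟨x, rfl⟩
      obtain ⟨y, h⟩ := h₁ x
      exact ⟨_, ⟨y, rfl⟩, h⟩
    · rintro _ ⟨y, rfl⟩
      obtain ⟨x, h⟩ := h₂ y
      exact ⟨_, ⟨x, rfl⟩, h⟩

theorem rankType_zero_eq_iff {X : Set (Fin k → M)} {Y : Set (Fin k → N)} {n : ℕ}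
    {a : Fin n → M} {b : Fin n → N} :
    rankType X 0 a = rankType Y 0 b ↔
      (∀ i j, a i = a j ↔ b i = b j) ∧ ∀ w : Fin k → Fin n, a ∘ w ∈ X ↔ b ∘ w ∈ Y := by
  refine Prod.ext_iff.trans ?_
  simp only [rankType, funext_iff, eq_iff_iff]

theorem rankType_succ_eq_iff {X : Set (Fin k → M)} {Y : Set (Fin k → N)} {r n : ℕ}
    {a : Fin n → M} {b : Fin n → N} :
    rankType X (r + 1) a = rankType Y (r + 1) b ↔
      (∀ x, ∃ y, rankType X r (Fin.snoc a x : Fin (n + 1) → M)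
        = rankType Y r (Fin.snoc b y : Fin (n + 1) → N)) ∧
      ∀ y, ∃ x, rankType X r (Fin.snoc a x : Fin (n + 1) → M)
        = rankType Y r (Fin.snoc b y : Fin (n + 1) → N) := by
  constructor
  · intro h
    have h' : ∀ τ, (∃ x, rankType X r (Fin.snoc a x : Fin (n + 1) → M) = τ) ↔
        ∃ y, rankType Y r (Fin.snoc b y : Fin (n + 1) → N) = τ := fun τ => Set.ext_iff.1 h τ
    refine ⟨fun x => ?_, fun y => ?_⟩
    · obtain ⟨y, hy⟩ := (h' _).1 ⟨x, rfl⟩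
      exact ⟨y, hy.symm⟩
    · exact (h' _).2 ⟨y, rfl⟩
  · rintro ⟨h₁, h₂⟩
    refine Set.ext fun τ => ⟨?_, ?_⟩
    · rintro ⟨x, rfl⟩
      obtain ⟨y, h⟩ := h₁ x
      exact ⟨y, h.symm⟩
    · rintro ⟨y, rfl⟩
      exact h₂ y

theorem le_rankType_refl (X : Set (Fin k → M)) (r : ℕ) {n : ℕ} (a : Fin n → M) :
    RankType.Le r (rankType X r a) (rankType X r a) := by
  induction r generalizing n with
  | zero => exact le_rankType_zero.2 ⟨fun _ _ => Iff.rfl, fun _ h => h⟩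
  | succ r ih => exact le_rankType_succ.2 ⟨fun x => ⟨x, ih _⟩, fun x => ⟨x, ih _⟩⟩

theorem atomic_of_le_rankType [Nonempty M] {X : Set (Fin k → M)} {Y : Set (Fin k → N)} (r : ℕ)
    {n : ℕ} {a : Fin n → M} {b : Fin n → N} (h : RankType.Le r (rankType X r a) (rankType Y r b)) :
    (∀ i j, a i = a j ↔ b i = b j) ∧ ∀ w : Fin k → Fin n, a ∘ w ∈ X → b ∘ w ∈ Y := by
  induction r generalizing n with
  | zero => exact le_rankType_zero.1 h
  | succ r ih =>
    obtain ⟨x⟩ := ‹Nonempty M›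
    obtain ⟨y, hy⟩ := (le_rankType_succ.1 h).1 x
    obtain ⟨h₁, h₂⟩ := ih hy
    refine ⟨fun i j => by simpa using h₁ i.castSucc j.castSucc, fun w hw => ?_⟩
    have := h₂ (Fin.castSucc ∘ w)
    simpa [← Function.comp_assoc, Fin.snoc_comp_castSucc, hw] using this

theorem rankType_eq_of_succ [Nonempty M] {X : Set (Fin k → M)} {Y : Set (Fin k → N)} {r n : ℕ}
    {a : Fin n → M} {b : Fin n → N} (h : rankType X (r + 1) a = rankType Y (r + 1) b) :
    rankType X r a = rankType Y r b := by
  induction r generalizing n with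
  | zero =>
    obtain ⟨x⟩ := ‹Nonempty M›
    obtain ⟨y, hy⟩ := (rankType_succ_eq_iff.1 h).1 x
    obtain ⟨h₁, h₂⟩ := rankType_zero_eq_iff.1 hy
    refine rankType_zero_eq_iff.2
      ⟨fun i j => by simpa using h₁ i.castSucc j.castSucc, fun w => ?_⟩
    have := h₂ (Fin.castSucc ∘ w)
    simpa [← Function.comp_assoc, Fin.snoc_comp_castSucc] using this
  | succ r ih =>
    obtain ⟨h₁, h₂⟩ := rankType_succ_eq_iff.1 h
    refine rankType_succ_eq_iff.2 ⟨fun x => ?_, fun y => ?_⟩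
    · obtain ⟨y, hy⟩ := h₁ x
      exact ⟨y, ih hy⟩
    · obtain ⟨x, hx⟩ := h₂ y
      exact ⟨x, ih hx⟩

theorem rankType_eq_of_le [Nonempty M] {X : Set (Fin k → M)} {Y : Set (Fin k → N)} {r r' n : ℕ}
    (hr : r ≤ r') {a : Fin n → M} {b : Fin n → N} (h : rankType X r' a = rankType Y r' b) :
    rankType X r a = rankType Y r b := by
  induction r', hr using Nat.le_induction with
  | base => exact h
  | succ r' _ ih => exact ih (rankType_eq_of_succ h)

/-- The relation symbols of the language with one `k`-ary relation. -/
inductive RelSymb (k : ℕ) : ℕ → Type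
  | symb : RelSymb k k

/-- The language with one `k`-ary relation symbol. -/
abbrev relLang (k : ℕ) : FirstOrder.Language.{0, 0} :=
  ⟨fun _ => Empty, RelSymb k⟩

/-- The structure `(M, X)`. -/
@[reducible] def relStructure (X : Set (Fin k → M)) : (relLang k).Structure M where
  funMap := fun f => Empty.elim f
  RelMap := fun
    | .symb, v => v ∈ X

theorem exists_rank_boundedFormula {n : ℕ} (φ : (relLang k).BoundedFormula Empty n) :
    ∃ r, ∀ (M N : Type) [Nonempty M] [Nonempty N] (X : Set (Fin k → M)) (Y : Set (Fin k → N))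
      (a : Fin n → M) (b : Fin n → N), rankType X r a = rankType Y r b →
      (@BoundedFormula.Realize _ M (relStructure X) _ _ φ default a ↔
        @BoundedFormula.Realize _ N (relStructure Y) _ _ φ default b) := by
  have var_term : ∀ {n : ℕ} (t : (relLang k).Term (Empty ⊕ Fin n)),
      ∃ i, t = Term.var (Sum.inr i) := by
    rintro n (⟨i⟩ | ⟨f, _⟩)
    · rcases i with i | i
      · exact i.elim
      · exact ⟨i, rfl⟩
    · exact Empty.elim f
  induction φ with
  | falsum => exact ⟨0, fun _ _ _ _ _ _ _ _ _ => Iff.rfl⟩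
  | equal t₁ t₂ =>
    refine ⟨0, fun M N _ _ X Y a b h => ?_⟩
    obtain ⟨i, rfl⟩ := var_term t₁
    obtain ⟨j, rfl⟩ := var_term t₂
    exact (rankType_zero_eq_iff.1 h).1 i j
  | rel R ts =>
    refine ⟨0, fun M N _ _ X Y a b h => ?_⟩
    choose w hw using fun i => var_term (ts i)
    obtain rfl : ts = fun i => Term.var (Sum.inr (w i)) := funext hw
    cases R
    exact (rankType_zero_eq_iff.1 h).2 w
  | imp φ ψ ih₁ ih₂ =>
    obtain ⟨r₁, h₁⟩ := ih₁
    obtain ⟨r₂, h₂⟩ := ih₂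
    refine ⟨max r₁ r₂, fun M N _ _ X Y a b h => ?_⟩
    exact imp_congr (h₁ M N X Y a b (rankType_eq_of_le (le_max_left _ _) h))
      (h₂ M N X Y a b (rankType_eq_of_le (le_max_right _ _) h))
  | all φ ih =>
    obtain ⟨r, hr⟩ := ih
    refine ⟨r + 1, fun M N _ _ X Y a b h => ?_⟩
    obtain ⟨h₁, h₂⟩ := rankType_succ_eq_iff.1 h
    refine ⟨fun H y => ?_, fun H x => ?_⟩
    · obtain ⟨x, hx⟩ := h₂ y
      exact (hr M N X Y _ _ hx).1 (H x)
    · obtain ⟨y, hy⟩ := h₁ x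
      exact (hr M N X Y _ _ hy).2 (H y)

/-- A property of structures with one `k`-ary relation that depends only on the rank `r` type. -/
def Determined (r : ℕ) (U : ∀ M : Type, Set (Fin k → M) → Prop) : Prop :=
  ∀ (M N : Type) [Nonempty M] [Nonempty N] (X : Set (Fin k → M)) (Y : Set (Fin k → N)),
    rankType X r (Fin.elim0 : Fin 0 → M) = rankType Y r (Fin.elim0 : Fin 0 → N) → U M X → U N Y

theorem exists_determined_sentence (φ : (relLang k).Sentence) :
    ∃ r, Determined r fun M (X : Set (Fin k → M)) =>
      @Sentence.Realize _ M (relStructure X) φ := by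
  obtain ⟨r, hr⟩ := exists_rank_boundedFormula φ
  refine ⟨r, fun M N _ _ X Y h H => ?_⟩
  have := hr M N X Y default default (by convert h)
  exact this.1 H

/-- A sequence built in stages, preserving `Inv` and attending to every requirement cofinally. -/
theorem exists_seq_of_requirements {E T : Type} [Countable T] [Nonempty T]
    (Inv : ∀ n, (Fin n → E) → Prop) (P : T → ∀ n, (Fin n → E) → E → Prop)
    (h_zero : ∀ c, Inv 0 c)
    (h_step : ∀ n c, Inv n c → ∀ t, ∃ e, Inv (n + 1) (Fin.snoc c e : Fin (n + 1) → E) ∧ P t n c e) :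
    ∃ c : ℕ → E, (∀ n, Inv n fun i => c i) ∧
      ∀ t N, ∃ n ≥ N, P t n (fun i => c i) (c n) := by
  obtain ⟨g, hg⟩ := exists_surjective_nat T
  choose e he using h_step
  let S : ∀ n, {c : Fin n → E // Inv n c} := fun n => Nat.rec ⟨Fin.elim0, h_zero _⟩
    (fun n c => ⟨_, (he n c.1 c.2 (g n.unpair.1)).1⟩) n
  have hS : ∀ n, (S (n + 1)).1 = Fin.snoc (S n).1 (e n (S n).1 (S n).2 (g n.unpair.1)) :=
    fun _ => rfl
  let c : ℕ → E := fun n => (S (n + 1)).1 (Fin.last n)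
  have hc : ∀ n, (S n).1 = fun i : Fin n => c i := by
    intro n
    induction n with
    | zero => exact Subsingleton.elim _ _
    | succ n ih =>
      refine funext fun i => ?_
      induction i using Fin.lastCases with
      | last => rfl
      | cast i =>
        rw [hS, Fin.snoc_castSucc, ih]
        rfl
  refine ⟨c, fun n => hc n ▸ (S n).2, fun t N => ?_⟩
  obtain ⟨a, rfl⟩ := hg t
  refine ⟨Nat.pair a N, Nat.right_le_pair _ _, ?_⟩
  have h := (he _ (S (Nat.pair a N)).1 (S (Nat.pair a N)).2 (g (Nat.pair a N).unpair.1)).2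
  have hlast : c (Nat.pair a N) = e _ (S (Nat.pair a N)).1 (S (Nat.pair a N)).2
      (g (Nat.pair a N).unpair.1) := by
    change (S (Nat.pair a N + 1)).1 (Fin.last _) = _
    rw [hS, Fin.snoc_last]
  rw [← hlast, hc, Nat.unpair_pair] at h
  exact h

/-- The limit along `u` of the relations `X m`, on a quotient of the indices of the sequence `c`. -/
def limitRel {A : ℕ → Type} (u : Ultrafilter ℕ) (X : ∀ m, Set (Fin k → A m)) (c : ℕ → ∀ m, A m)
    (s : Setoid ℕ) : Set (Fin k → Quotient s) :=
  {q | ∃ w : Fin k → ℕ, (fun i => (⟦w i⟧ : Quotient s)) = q ∧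
    ∀ᶠ m in u, (fun i => c (w i) m) ∈ X m}

theorem eventually_iff_of_iff_eventually {u : Ultrafilter ℕ} {p : ℕ → Prop} {q : Prop}
    (h : q ↔ ∀ᶠ m in u, p m) : ∀ᶠ m in u, (p m ↔ q) := by
  by_cases hq : q
  · simpa [hq] using h.1 hq
  · have := mt h.2 hq
    rw [← Ultrafilter.eventually_not] at this
    simpa [hq] using this

theorem eventually_rankType_eq_limit {A : ℕ → Type} (u : Ultrafilter ℕ)
    (X : ∀ m, Set (Fin k → A m)) (c : ℕ → ∀ m, A m) (s : Setoid ℕ)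
    (hs : ∀ i j, s i j ↔ ∀ᶠ m in u, c i m = c j m)
    (hc : ∀ p (idx : Fin p → ℕ) r (τ : RankType k r (p + 1)),
      (∃ x : ∀ m, A m, ∀ᶠ m in u,
        rankType (X m) r (Fin.snoc (fun i => c (idx i) m) (x m) : Fin (p + 1) → A m) = τ) →
      ∃ n, ∀ᶠ m in u,
        rankType (X m) r (Fin.snoc (fun i => c (idx i) m) (c n m) : Fin (p + 1) → A m) = τ)
    [∀ m, Nonempty (A m)] (r : ℕ) {p : ℕ} (idx : Fin p → ℕ) :
    ∀ᶠ m in u, rankType (X m) r (fun i => c (idx i) m) =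
      rankType (limitRel u X c s) r (fun i => (⟦idx i⟧ : Quotient s)) := by
  induction r generalizing p with
  | zero =>
    simp only [rankType_zero_eq_iff]
    refine Filter.Eventually.and ?_ ?_
    · simp only [Filter.eventually_all]
      exact fun i j => eventually_iff_of_iff_eventually (Quotient.eq.trans (hs _ _))
    · simp only [Filter.eventually_all]
      refine fun w => eventually_iff_of_iff_eventually ⟨?_, fun h => ⟨_, rfl, h⟩⟩
      rintro ⟨w', hw', h⟩
      have key : ∀ᶠ m in u, ∀ i, c (w' i) m = c (idx (w i)) m := by
        rw [Filter.eventually_all]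
        exact fun i => (hs _ _).1 (Quotient.eq.1 (congrFun hw' i))
      filter_upwards [h, key] with m h₁ h₂
      rwa [funext h₂] at h₁
  | succ r ih =>
    have snoc_eq : ∀ n m, (Fin.snoc (fun i => c (idx i) m) (c n m) : Fin (p + 1) → A m) =
        fun i => c ((Fin.snoc idx n : Fin (p + 1) → ℕ) i) m := fun n m =>
      (Fin.comp_snoc (fun i => c i m) idx n).symm
    have snoc_mk : ∀ n, (Fin.snoc (fun i => (⟦idx i⟧ : Quotient s)) ⟦n⟧ : Fin (p + 1) → _) =
        fun i => ⟦(Fin.snoc idx n : Fin (p + 1) → ℕ) i⟧ := fun n =>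
      (Fin.comp_snoc (fun i => (⟦i⟧ : Quotient s)) idx n).symm
    have := RankType.finite k r (p + 1)
    suffices h : ∀ᶠ m in u, ∀ τ : RankType k r (p + 1),
        ((∃ x, rankType (X m) r (Fin.snoc (fun i => c (idx i) m) x : Fin (p + 1) → A m) = τ) ↔
          ∃ q, rankType (limitRel u X c s) r
            (Fin.snoc (fun i => (⟦idx i⟧ : Quotient s)) q : Fin (p + 1) → _) = τ) by
      filter_upwards [h] with m hm
      exact Set.ext hm
    rw [Filter.eventually_all]
    refine fun τ => eventually_iff_of_iff_eventually ⟨?_, fun h => ?_⟩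
    · rintro ⟨q, hq⟩
      induction q using Quotient.inductionOn with
      | h n =>
        filter_upwards [ih (Fin.snoc idx n : Fin (p + 1) → ℕ)] with m hm
        exact ⟨c n m, by rw [snoc_eq, hm, ← hq, snoc_mk]⟩
    · have hx : ∀ m, ∃ x : A m,
          (∃ x, rankType (X m) r (Fin.snoc (fun i => c (idx i) m) x : Fin (p + 1) → A m) = τ) →
          rankType (X m) r (Fin.snoc (fun i => c (idx i) m) x : Fin (p + 1) → A m) = τ := by
        intro m
        by_cases H : ∃ x, rankType (X m) r
          (Fin.snoc (fun i => c (idx i) m) x : Fin (p + 1) → A m) = τ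
        · exact ⟨_, fun _ => H.choose_spec⟩
        · exact ⟨Classical.arbitrary _, fun h => absurd h H⟩
      choose x hx using hx
      obtain ⟨n, hn⟩ := hc p idx r τ ⟨x, h.mono hx⟩
      obtain ⟨m, h₁, h₂⟩ := (hn.and (ih (Fin.snoc idx n : Fin (p + 1) → ℕ))).exists
      exact ⟨⟦n⟧, by rw [snoc_mk, ← h₂, ← snoc_eq, h₁]⟩

/-- A class of structures that is preserved under enlarging the relation and is determined by
types of bounded rank is preserved under `RankType.Le` for some rank. -/
theorem exists_rank_le_preserved {r : ℕ} {U : ∀ M : Type, Set (Fin k → M) → Prop}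
    (hU : Determined r U)
    (h_up : ∀ (M : Type) [Nonempty M] (X Y : Set (Fin k → M)), X ⊆ Y → U M X → U M Y) :
    ∃ m, ∀ (M N : Type) [Nonempty M] [Nonempty N] (X : Set (Fin k → M)) (Y : Set (Fin k → N)),
      RankType.Le m (rankType X m (Fin.elim0 : Fin 0 → M)) (rankType Y m (Fin.elim0 : Fin 0 → N)) →
      U M X → U N Y := by
  by_contra! hcon
  choose A B hA hB X Y hle hX hY using hcon
  let u := Filter.hyperfilter ℕ
  have hgt : ∀ n, ∀ᶠ m in u, n < m := fun n =>
    (Filter.eventually_gt_atTop n).filter_mono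
      (by simpa [u, Nat.cofinite_eq_atTop] using Filter.hyperfilter_le_cofinite (α := ℕ))
  let E := (∀ m, A m) × (∀ m, B m)
  let T := Bool × Σ p : ℕ, (Fin p → ℕ) × Σ r : ℕ, RankType k r (p + 1)
  let Inv : ∀ n, (Fin n → E) → Prop := fun n c => ∀ᶠ m in u,
    RankType.Le (m - n) (rankType (X m) (m - n) fun i => (c i).1 m)
      (rankType (Y m) (m - n) fun i => (c i).2 m)
  have snoc_fst : ∀ n (c : Fin n → E) x y m, (fun i => ((Fin.snoc c (x, y) : Fin (n + 1) → E) i).1 m)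
      = (Fin.snoc (fun i => (c i).1 m) (x m) : Fin (n + 1) → A m) :=
    fun _ c x y m => Fin.comp_snoc (fun e : E => e.1 m) c (x, y)
  have snoc_snd : ∀ n (c : Fin n → E) x y m, (fun i => ((Fin.snoc c (x, y) : Fin (n + 1) → E) i).2 m)
      = (Fin.snoc (fun i => (c i).2 m) (y m) : Fin (n + 1) → B m) :=
    fun _ c x y m => Fin.comp_snoc (fun e : E => e.2 m) c (x, y)
  have inv_left : ∀ n (c : Fin n → E), Inv n c → ∀ x : ∀ m, A m, ∃ y : ∀ m, B m,
      Inv (n + 1) (Fin.snoc c (x, y) : Fin (n + 1) → E) := by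
    intro n c h x
    have key : ∀ m, ∃ y : B m, n < m → RankType.Le (m - n)
        (rankType (X m) (m - n) fun i => (c i).1 m) (rankType (Y m) (m - n) fun i => (c i).2 m) →
        RankType.Le (m - (n + 1))
          (rankType (X m) (m - (n + 1)) (Fin.snoc (fun i => (c i).1 m) (x m) : Fin (n + 1) → A m))
          (rankType (Y m) (m - (n + 1)) (Fin.snoc (fun i => (c i).2 m) y : Fin (n + 1) → B m)) := by
      intro m
      by_cases H : n < m ∧ RankType.Le (m - n)
        (rankType (X m) (m - n) fun i => (c i).1 m) (rankType (Y m) (m - n) fun i => (c i).2 m)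
      · obtain ⟨hm, H⟩ := H
        rw [show m - n = m - (n + 1) + 1 by omega] at H
        obtain ⟨y, hy⟩ := (le_rankType_succ.1 H).1 (x m)
        exact ⟨y, fun _ _ => hy⟩
      · exact ⟨Classical.arbitrary _, fun h₁ h₂ => absurd ⟨h₁, h₂⟩ H⟩
    choose y hy using key
    refine ⟨y, ?_⟩
    filter_upwards [h, hgt n] with m h₁ h₂
    rw [snoc_fst, snoc_snd]
    exact hy m h₂ h₁
  have inv_right : ∀ n (c : Fin n → E), Inv n c → ∀ y : ∀ m, B m, ∃ x : ∀ m, A m,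
      Inv (n + 1) (Fin.snoc c (x, y) : Fin (n + 1) → E) := by
    intro n c h y
    have key : ∀ m, ∃ x : A m, n < m → RankType.Le (m - n)
        (rankType (X m) (m - n) fun i => (c i).1 m) (rankType (Y m) (m - n) fun i => (c i).2 m) →
        RankType.Le (m - (n + 1))
          (rankType (X m) (m - (n + 1)) (Fin.snoc (fun i => (c i).1 m) x : Fin (n + 1) → A m))
          (rankType (Y m) (m - (n + 1))
            (Fin.snoc (fun i => (c i).2 m) (y m) : Fin (n + 1) → B m)) := by
      intro m
      by_cases H : n < m ∧ RankType.Le (m - n)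
        (rankType (X m) (m - n) fun i => (c i).1 m) (rankType (Y m) (m - n) fun i => (c i).2 m)
      · obtain ⟨hm, H⟩ := H
        rw [show m - n = m - (n + 1) + 1 by omega] at H
        obtain ⟨x, hx⟩ := (le_rankType_succ.1 H).2 (y m)
        exact ⟨x, fun _ _ => hx⟩
      · exact ⟨Classical.arbitrary _, fun h₁ h₂ => absurd ⟨h₁, h₂⟩ H⟩
    choose x hx using key
    refine ⟨x, ?_⟩
    filter_upwards [h, hgt n] with m h₁ h₂
    rw [snoc_fst, snoc_snd]
    exact hx m h₂ h₁
  let P : T → ∀ n, (Fin n → E) → E → Prop := fun t n c e => ∀ h : ∀ i, t.2.2.1 i < n,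
    match t.1 with
    | true => (∃ x : ∀ m, A m, ∀ᶠ m in u, rankType (X m) t.2.2.2.1
        (Fin.snoc (fun i => (c ⟨_, h i⟩).1 m) (x m) : Fin (t.2.1 + 1) → A m) = t.2.2.2.2) →
      ∀ᶠ m in u, rankType (X m) t.2.2.2.1
        (Fin.snoc (fun i => (c ⟨_, h i⟩).1 m) (e.1 m) : Fin (t.2.1 + 1) → A m) = t.2.2.2.2
    | false => (∃ y : ∀ m, B m, ∀ᶠ m in u, rankType (Y m) t.2.2.2.1
        (Fin.snoc (fun i => (c ⟨_, h i⟩).2 m) (y m) : Fin (t.2.1 + 1) → B m) = t.2.2.2.2) →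
      ∀ᶠ m in u, rankType (Y m) t.2.2.2.1
        (Fin.snoc (fun i => (c ⟨_, h i⟩).2 m) (e.2 m) : Fin (t.2.1 + 1) → B m) = t.2.2.2.2
  have : Nonempty T := ⟨(true, ⟨0, Fin.elim0, 1, (∅ : Set _)⟩)⟩
  obtain ⟨c, hinv, hreq⟩ := exists_seq_of_requirements Inv P
    (fun c => Filter.Eventually.of_forall fun m => by
      convert hle m
      first | exact Subsingleton.elim _ _ | rfl)
    (by
      rintro n c hc ⟨b, p, idx, r, τ⟩
      by_cases hidx : ∀ i, idx i < n
      · cases b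
        · by_cases H : ∃ y : ∀ m, B m, ∀ᶠ m in u, rankType (Y m) r
            (Fin.snoc (fun i => (c ⟨_, hidx i⟩).2 m) (y m) : Fin (p + 1) → B m) = τ
          · obtain ⟨y, hy⟩ := H
            obtain ⟨x, hx⟩ := inv_right n c hc y
            exact ⟨(x, y), hx, fun _ _ => hy⟩
          · obtain ⟨x, hx⟩ := inv_right n c hc fun m => Classical.arbitrary _
            exact ⟨_, hx, fun _ h => absurd h H⟩
        · by_cases H : ∃ x : ∀ m, A m, ∀ᶠ m in u, rankType (X m) r
            (Fin.snoc (fun i => (c ⟨_, hidx i⟩).1 m) (x m) : Fin (p + 1) → A m) = τ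
          · obtain ⟨x, hx⟩ := H
            obtain ⟨y, hy⟩ := inv_left n c hc x
            exact ⟨(x, y), hy, fun _ _ => hx⟩
          · obtain ⟨y, hy⟩ := inv_left n c hc fun m => Classical.arbitrary _
            exact ⟨_, hy, fun _ h => absurd h H⟩
      · obtain ⟨y, hy⟩ := inv_left n c hc fun m => Classical.arbitrary _
        exact ⟨_, hy, fun h => absurd h hidx⟩)
  have bound : ∀ {p : ℕ} (idx : Fin p → ℕ), ∃ N, ∀ i, idx i < N := fun idx => by
    obtain ⟨N, hN⟩ := (Set.finite_range idx).bddAbove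
    exact ⟨N + 1, fun i => Nat.lt_succ_of_le (hN ⟨i, rfl⟩)⟩
  have atomic : ∀ n, ∀ᶠ m in u,
      (∀ i j : Fin n, (c i).1 m = (c j).1 m ↔ (c i).2 m = (c j).2 m) ∧
      ∀ w : Fin k → Fin n, (fun i => (c (w i)).1 m) ∈ X m → (fun i => (c (w i)).2 m) ∈ Y m :=
    fun n => (hinv n).mono fun m hm => atomic_of_le_rankType _ hm
  let s : Setoid ℕ := ⟨fun i j => ∀ᶠ m in u, (c i).1 m = (c j).1 m,
    fun i => Filter.Eventually.of_forall fun _ => rfl,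
    fun h => h.mono fun _ => Eq.symm,
    fun h₁ h₂ => (h₁.and h₂).mono fun _ h => h.1.trans h.2⟩
  have hs : ∀ i j, s i j ↔ ∀ᶠ m in u, (c i).2 m = (c j).2 m := fun i j => by
    obtain ⟨N, hN⟩ := bound ![i, j]
    refine Filter.eventually_congr ((atomic N).mono fun m hm => ?_)
    exact hm.1 ⟨i, hN 0⟩ ⟨j, hN 1⟩
  have hleft := eventually_rankType_eq_limit u X (fun i => (c i).1) s (fun _ _ => Iff.rfl)
    (fun p idx r τ h => by
      obtain ⟨N, hN⟩ := bound idx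
      obtain ⟨n, hn, H⟩ := hreq (true, ⟨p, idx, r, τ⟩) N
      exact ⟨n, H (fun i => (hN i).trans_le hn) h⟩) r (Fin.elim0 : Fin 0 → ℕ)
  have hright := eventually_rankType_eq_limit u Y (fun i => (c i).2) s hs
    (fun p idx r τ h => by
      obtain ⟨N, hN⟩ := bound idx
      obtain ⟨n, hn, H⟩ := hreq (false, ⟨p, idx, r, τ⟩) N
      exact ⟨n, H (fun i => (hN i).trans_le hn) h⟩) r (Fin.elim0 : Fin 0 → ℕ)
  have hsub : limitRel u X (fun i => (c i).1) s ⊆ limitRel u Y (fun i => (c i).2) s := by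
    rintro _ ⟨w, rfl, hw⟩
    obtain ⟨N, hN⟩ := bound w
    refine ⟨w, rfl, ?_⟩
    filter_upwards [hw, atomic N] with m h₁ h₂
    exact h₂.2 (fun i => ⟨w i, hN i⟩) h₁
  have : Nonempty (Quotient s) := ⟨⟦0⟧⟩
  obtain ⟨m, h₁, h₂⟩ := (hleft.and hright).exists
  refine hY m (hU (Quotient s) (B m) (limitRel u Y (fun i => (c i).2) s) (Y m) ?_
    (h_up _ _ _ hsub (hU (A m) (Quotient s) (X m) _ ?_ (hX m))))
  · convert h₂.symm
  · convert h₁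

/-- Quantifier-free formulas in `n` variables over equality and one `k`-ary relation. -/
inductive QF (k n : ℕ) : Type
  | tru
  | eq (i j : Fin n)
  | rel (w : Fin k → Fin n)
  | not (φ : QF k n)
  | and (φ ψ : QF k n)

namespace QF

/-- Truth of a quantifier-free formula in `(M, B)`. -/
def Eval (B : Set (Fin k → M)) {n : ℕ} (v : Fin n → M) : QF k n → Prop
  | tru => True
  | eq i j => v i = v j
  | rel w => v ∘ w ∈ B
  | not φ => ¬ φ.Eval B v
  | and φ ψ => φ.Eval B v ∧ ψ.Eval B v

/-- Renaming of variables. -/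
def rename {n m : ℕ} (f : Fin n → Fin m) : QF k n → QF k m
  | tru => tru
  | eq i j => eq (f i) (f j)
  | rel w => rel (f ∘ w)
  | not φ => not (φ.rename f)
  | and φ ψ => and (φ.rename f) (ψ.rename f)

/-- Disjunction. -/
def or {n : ℕ} (φ ψ : QF k n) : QF k n := not (and (not φ) (not ψ))

theorem eval_rename {n m : ℕ} (f : Fin n → Fin m) (B : Set (Fin k → M)) (v : Fin m → M)
    (φ : QF k n) : (φ.rename f).Eval B v ↔ φ.Eval B (v ∘ f) := by
  induction φ with
  | tru => rfl
  | eq i j => rfl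
  | rel w => rfl
  | not φ ih => exact not_congr ih
  | and φ ψ ih₁ ih₂ => exact and_congr ih₁ ih₂

theorem eval_or {n : ℕ} {B : Set (Fin k → M)} {v : Fin n → M} {φ ψ : QF k n} :
    (φ.or ψ).Eval B v ↔ φ.Eval B v ∨ ψ.Eval B v := by
  simp only [or, Eval]
  tauto

theorem exists_eval_iff_comp_eq {n : ℕ} (w z : Fin k → Fin n) :
    ∃ φ : QF k n, ∀ (M : Type) (B : Set (Fin k → M)) v, φ.Eval B v ↔ v ∘ w = v ∘ z := by
  suffices h : ∀ s : Finset (Fin k), ∃ φ : QF k n, ∀ (M : Type) (B : Set (Fin k → M)) v,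
      φ.Eval B v ↔ ∀ i ∈ s, v (w i) = v (z i) by
    obtain ⟨φ, hφ⟩ := h Finset.univ
    exact ⟨φ, fun M B v => by simp [hφ, funext_iff]⟩
  intro s
  induction s using Finset.induction_on with
  | empty => exact ⟨tru, by simp [Eval]⟩
  | insert i s _ ih =>
    obtain ⟨φ, hφ⟩ := ih
    exact ⟨and (eq (w i) (z i)) φ, by simp [Eval, hφ]⟩

/-- The formula of `FO(D)` expressing `φ` (or its negation). -/
def toTS (D : Dependency k) {n : ℕ} :
    Bool → QF k n → TSFormula (relLang k) (fun _ : Unit => (⟨k, D⟩ : (k : ℕ) × Dependency k))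
  | true, tru => .fa 0 (.equal (Term.var 0) (Term.var 0))
  | false, tru => .fa 0 (.nequal (Term.var 0) (Term.var 0))
  | true, eq i j => .equal (Term.var i) (Term.var j)
  | false, eq i j => .nequal (Term.var i) (Term.var j)
  | true, rel w => .rel (RelSymb.symb : RelSymb k k) fun i => Term.var (w i)
  | false, rel w => .nrel (RelSymb.symb : RelSymb k k) fun i => Term.var (w i)
  | b, not φ => toTS D (!b) φ
  | true, and φ ψ => .conj (toTS D true φ) (toTS D true ψ)
  | false, and φ ψ => .disj (toTS D false φ) (toTS D false ψ)

theorem sat_toTS (D : Dependency k) [Nonempty M] (B : Set (Fin k → M)) {n : ℕ} (b : Bool)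
    (φ : QF k n) (Z : Set (ℕ → M)) :
    @TSFormula.Sat _ _ _ M (relStructure B) (φ.toTS D b) Z ↔
      ∀ s ∈ Z, (φ.Eval B (fun i => s i) ↔ b = true) := by
  induction φ generalizing b Z with
  | tru =>
    cases b
    · simp only [toTS, TSFormula.Sat, Term.realize_var, Eval]
      exact ⟨fun h s hs => absurd rfl (h _ ⟨s, hs, Classical.arbitrary M, rfl⟩),
        fun h _ ⟨s, hs, _⟩ => absurd (h s hs) (by simp)⟩
    · simp [toTS, TSFormula.Sat, Eval]
  | eq i j => cases b <;> simp [toTS, TSFormula.Sat, Eval]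
  | rel w =>
    cases b
    · simp only [toTS, TSFormula.Sat, Eval, Bool.false_eq_true, iff_false]
      rfl
    · simp only [toTS, TSFormula.Sat, Eval, iff_true]
      rfl
  | not φ ih =>
    have : (not φ).toTS D b = φ.toTS D (!b) := by cases b <;> rfl
    rw [this, ih]
    cases b <;> simp [Eval]
  | and φ ψ ih₁ ih₂ =>
    cases b
    · simp only [toTS, TSFormula.Sat, ih₁, ih₂, Eval]
      constructor
      · rintro ⟨Y, W, rfl, hY, hW⟩ s (hs | hs)
        · simpa using fun h => absurd h (by simpa using hY s hs)
        · simpa using fun _ => by simpa using hW s hs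
      · intro h
        refine ⟨{s ∈ Z | ¬ φ.Eval B fun i => s i}, {s ∈ Z | ¬ ψ.Eval B fun i => s i}, ?_, ?_, ?_⟩
        · ext s
          have := h s
          simp only [Set.mem_union, Set.mem_ofPred_eq]
          simp only [Bool.false_eq_true, iff_false] at this
          tauto
        · simp
        · simp
    · simp only [toTS, TSFormula.Sat, ih₁, ih₂, Eval]
      simp only [iff_true]
      exact forall₂_and.symm

theorem freeVars_toTS (D : Dependency k) {n : ℕ} (b : Bool) (φ : QF k n) :
    (φ.toTS D b).freeVars ⊆ {i | i < n} := by
  induction φ generalizing b with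
  | tru => cases b <;> simp [toTS, TSFormula.freeVars, termVars]
  | eq i j => cases b <;> simp [toTS, TSFormula.freeVars, termVars, Set.insert_subset_iff]
  | rel w =>
    cases b <;> simp [toTS, TSFormula.freeVars, termVars, Set.range_subset_iff]
  | not φ ih =>
    have : (not φ).toTS D b = φ.toTS D (!b) := by cases b <;> rfl
    rw [this]
    exact ih _
  | and φ ψ ih₁ ih₂ => cases b <;> exact Set.union_subset (ih₁ _) (ih₂ _)

end QF

/-- Prenex formulas whose matrix mentions the second relation `X` once and positively. -/
inductive Game (k : ℕ) : ℕ → Type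
  | leaf {n : ℕ} (a b : QF k n) (w : Fin k → Fin n) : Game k n
  | ex {n : ℕ} (G : Game k (n + 1)) : Game k n
  | all {n : ℕ} (G : Game k (n + 1)) : Game k n

namespace Game

/-- Truth of a prenex formula in `(M, B, X)`. -/
def Holds (B X : Set (Fin k → M)) : {n : ℕ} → Game k n → (Fin n → M) → Prop
  | _, leaf a b w, v => a.Eval B v ∨ (b.Eval B v ∧ v ∘ w ∈ X)
  | n, ex G, v => ∃ x, G.Holds B X (Fin.snoc v x : Fin (n + 1) → M)
  | n, all G, v => ∀ x, G.Holds B X (Fin.snoc v x : Fin (n + 1) → M)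

/-- The formula of `FO(D)` expressing that some `X` in `D` satisfies the game. -/
def toTS (D : Dependency k) : {n : ℕ} → Game k n →
    TSFormula (relLang k) (fun _ : Unit => (⟨k, D⟩ : (k : ℕ) × Dependency k))
  | _, leaf a b w => .disj (a.toTS D true) (.conj (b.toTS D true) (.depAtom () fun i => (w i : ℕ)))
  | n, ex G => .ex n (G.toTS D)
  | n, all G => .fa n (G.toTS D)

theorem update_restrict (s : ℕ → M) (n : ℕ) (x : M) :
    (fun i : Fin (n + 1) => Function.update s n x i) =
      (Fin.snoc (fun i : Fin n => s i) x : Fin (n + 1) → M) := by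
  refine funext fun i => ?_
  induction i using Fin.lastCases with
  | last => simp
  | cast i => simp [i.2.ne]

theorem sat_toTS {D : Dependency k} (hdc : D.DownwardsClosed) [Nonempty M]
    (B : Set (Fin k → M)) {n : ℕ} (G : Game k n) (Z : Set (ℕ → M)) :
    @TSFormula.Sat _ _ _ M (relStructure B) (G.toTS D) Z ↔
      ∃ X, D.Mem M X ∧ ∀ s ∈ Z, G.Holds B X (fun i => s i) := by
  induction G generalizing Z with
  | leaf a b w =>
    simp only [toTS, TSFormula.Sat, QF.sat_toTS, Holds, iff_true]
    constructor
    · rintro ⟨Y, W, rfl, hY, hb, hD⟩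
      refine ⟨_, hD, ?_⟩
      rintro s (hs | hs)
      · exact Or.inl (hY s hs)
      · exact Or.inr ⟨hb s hs, s, hs, rfl⟩
    · rintro ⟨X, hX, h⟩
      refine ⟨{s ∈ Z | a.Eval B fun i => s i},
        {s ∈ Z | (b.Eval B fun i => s i) ∧ (fun i => s (w i)) ∈ X}, ?_, ?_, ?_, ?_⟩
      · ext s
        have := h s
        simp only [Function.comp_def] at this
        simp only [Set.mem_union, Set.mem_ofPred_eq]
        tauto
      · exact fun s hs => hs.2
      · exact fun s hs => hs.2.1
      · refine hdc _ _ _ hX ?_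
        rintro _ ⟨s, hs, rfl⟩
        exact hs.2.2
  | @ex n G ih =>
    simp only [toTS, TSFormula.Sat, ih, Holds]
    constructor
    · rintro ⟨H, hH, X, hX, h⟩
      refine ⟨X, hX, fun s hs => ?_⟩
      obtain ⟨x, hx⟩ := hH s hs
      have := h _ ⟨s, hs, x, hx, rfl⟩
      exact ⟨x, by rwa [update_restrict] at this⟩
    · rintro ⟨X, hX, h⟩
      refine ⟨fun s => {x | G.Holds B X (Fin.snoc (fun i : Fin n => s i) x : Fin (n + 1) → M)},
        fun s hs => h s hs, X, hX, ?_⟩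
      rintro _ ⟨s, _, x, hx, rfl⟩
      rw [update_restrict]
      exact hx
  | @all n G ih =>
    simp only [toTS, TSFormula.Sat, ih, Holds]
    refine exists_congr fun X => and_congr_right fun _ => ⟨fun h s hs x => ?_, ?_⟩
    · have := h _ ⟨s, hs, x, rfl⟩
      rwa [update_restrict] at this
    · rintro h _ ⟨s, hs, x, rfl⟩
      rw [update_restrict]
      exact h s hs x

theorem freeVars_toTS (D : Dependency k) {n : ℕ} (G : Game k n) :
    (G.toTS D).freeVars ⊆ {i | i < n} := by
  induction G with
  | leaf a b w =>
    refine Set.union_subset (QF.freeVars_toTS D _ _)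
      (Set.union_subset (QF.freeVars_toTS D _ _) ?_)
    rintro _ ⟨i, rfl⟩
    exact (w i).2
  | ex G ih =>
    rintro i ⟨h₁, h₂⟩
    exact lt_of_le_of_ne (Nat.lt_succ_iff.1 (ih h₁)) h₂
  | all G ih =>
    rintro i ⟨h₁, h₂⟩
    exact lt_of_le_of_ne (Nat.lt_succ_iff.1 (ih h₁)) h₂

theorem exists_determined {D : Dependency k} (hdc : D.DownwardsClosed) (hsfo : StronglyFirstOrder D)
    (G : Game k 0) : ∃ r, Determined r fun M (B : Set (Fin k → M)) =>
      ∃ X, D.Mem M X ∧ G.Holds B X Fin.elim0 := by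
  obtain ⟨ψ, hψ⟩ := hsfo (relLang k) (G.toTS D)
    (Set.subset_eq_empty (G.freeVars_toTS D) (by simp))
  obtain ⟨r, hr⟩ := exists_determined_sentence ψ
  have key : ∀ (M : Type) [Nonempty M] (B : Set (Fin k → M)),
      (∃ X, D.Mem M X ∧ G.Holds B X Fin.elim0) ↔ @Sentence.Realize _ M (relStructure B) ψ := by
    intro M _ B
    rw [← @hψ M (relStructure B) _]
    simp only [TSFormula.TrueIn, sat_toTS hdc, Set.mem_singleton_iff, forall_eq]
    constructor
    · rintro ⟨X, hX, h⟩ s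
      exact ⟨X, hX, by convert h⟩
    · intro h
      obtain ⟨X, hX, h⟩ := h fun _ => Classical.arbitrary M
      exact ⟨X, hX, by convert h⟩
  exact ⟨r, fun M N _ _ X Y h H => (key N Y).2 (hr M N X Y h ((key M X).1 H))⟩

end Game

/-- A property of `(M, B, X, v)` that is expressed by a game whenever `M` has at least two
elements. -/
def GameDef (n : ℕ)
    (Φ : ∀ M : Type, Set (Fin k → M) → Set (Fin k → M) → (Fin n → M) → Prop) : Prop :=
  ∃ G : Game k n, ∀ (M : Type) [Nontrivial M] (B X : Set (Fin k → M)) (v : Fin n → M),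
    G.Holds B X v ↔ Φ M B X v

namespace GameDef

variable {n : ℕ} {Φ Ψ : ∀ M : Type, Set (Fin k → M) → Set (Fin k → M) → (Fin n → M) → Prop}

theorem congr (hΦ : GameDef n Φ)
    (h : ∀ (M : Type) [Nontrivial M] (B X : Set (Fin k → M)) (v : Fin n → M),
      Φ M B X v ↔ Ψ M B X v) : GameDef n Ψ := by
  obtain ⟨G, hG⟩ := hΦ
  exact ⟨G, fun M _ B X v => (hG M B X v).trans (h M B X v)⟩

theorem ex {Φ : ∀ M : Type, Set (Fin k → M) → Set (Fin k → M) → (Fin (n + 1) → M) → Prop}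
    (hΦ : GameDef (n + 1) Φ) :
    GameDef n fun M B X v => ∃ x, Φ M B X (Fin.snoc v x : Fin (n + 1) → M) := by
  obtain ⟨G, hG⟩ := hΦ
  exact ⟨.ex G, fun M _ B X v => exists_congr fun x => hG M B X _⟩

theorem all {Φ : ∀ M : Type, Set (Fin k → M) → Set (Fin k → M) → (Fin (n + 1) → M) → Prop}
    (hΦ : GameDef (n + 1) Φ) :
    GameDef n fun M B X v => ∀ x, Φ M B X (Fin.snoc v x : Fin (n + 1) → M) := by
  obtain ⟨G, hG⟩ := hΦ
  exact ⟨.all G, fun M _ B X v => forall_congr' fun x => hG M B X _⟩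

theorem exBlock {j : ℕ}
    {Φ : ∀ M : Type, Set (Fin k → M) → Set (Fin k → M) → (Fin (n + j) → M) → Prop}
    (hΦ : GameDef (n + j) Φ) :
    GameDef n fun M B X v => ∃ z : Fin j → M, Φ M B X (Fin.append v z) := by
  induction j with
  | zero =>
    refine hΦ.congr fun M _ B X v => ⟨fun h => ⟨Fin.elim0, ?_⟩, fun ⟨z, h⟩ => ?_⟩
    · rwa [Fin.append_elim0]
    · rwa [Subsingleton.elim z Fin.elim0, Fin.append_elim0] at h
  | succ j ih =>
    refine (ih hΦ.ex).congr fun M _ B X v => ⟨fun ⟨z, x, h⟩ => ⟨Fin.snoc z x, ?_⟩, fun ⟨z, h⟩ =>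
      ⟨Fin.init z, z (Fin.last j), ?_⟩⟩
    · rwa [Fin.append_snoc]
    · rwa [← Fin.append_snoc, Fin.snoc_init_self]

theorem allBlock {j : ℕ}
    {Φ : ∀ M : Type, Set (Fin k → M) → Set (Fin k → M) → (Fin (n + j) → M) → Prop}
    (hΦ : GameDef (n + j) Φ) :
    GameDef n fun M B X v => ∀ z : Fin j → M, Φ M B X (Fin.append v z) := by
  induction j with
  | zero =>
    refine hΦ.congr fun M _ B X v => ⟨fun h z => ?_, fun h => ?_⟩
    · rwa [Subsingleton.elim z Fin.elim0, Fin.append_elim0]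
    · have := h Fin.elim0
      rwa [Fin.append_elim0] at this
  | succ j ih =>
    refine (ih hΦ.all).congr fun M _ B X v => ⟨fun h z => ?_, fun h z x => ?_⟩
    · have := h (Fin.init z) (z (Fin.last j))
      rwa [← Fin.append_snoc, Fin.snoc_init_self] at this
    · rw [← Fin.append_snoc]
      exact h _

theorem rename_holds (G : Game k n) {m : ℕ} (f : Fin n → Fin m) :
    GameDef m fun _ B X v => G.Holds B X (v ∘ f) := by
  have snoc_comp : ∀ {n m : ℕ} (f : Fin n → Fin m) {M : Type} (v : Fin m → M) (x : M),
      (Fin.snoc v x : Fin (m + 1) → M) ∘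
        (Fin.snoc (Fin.castSucc ∘ f) (Fin.last m) : Fin (n + 1) → Fin (m + 1)) =
      Fin.snoc (v ∘ f) x := fun f M v x => by
    rw [Fin.comp_snoc, ← Function.comp_assoc, Fin.snoc_comp_castSucc, Fin.snoc_last]
  induction G generalizing m with
  | leaf a b w =>
    exact ⟨.leaf (a.rename f) (b.rename f) (f ∘ w), fun M _ B X v => by
      simp only [Game.Holds, QF.eval_rename]
      rfl⟩
  | ex G ih =>
    refine (ih (Fin.snoc (Fin.castSucc ∘ f) (Fin.last m))).ex.congr fun M _ B X v => ?_
    simp only [snoc_comp]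
    rfl
  | all G ih =>
    refine (ih (Fin.snoc (Fin.castSucc ∘ f) (Fin.last m))).all.congr fun M _ B X v => ?_
    simp only [snoc_comp]
    rfl

theorem rename {m : ℕ} (hΦ : GameDef n Φ) (f : Fin n → Fin m) :
    GameDef m fun M B X v => Φ M B X (v ∘ f) := by
  obtain ⟨G, hG⟩ := hΦ
  exact (rename_holds G f).congr fun M _ B X v => hG M B X _

theorem qf (a : QF k n) : GameDef n fun _ B _ v => a.Eval B v :=
  ⟨.ex (.leaf (a.rename Fin.castSucc) (.not .tru) fun _ => Fin.last n), fun M _ B X v => by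
    simp [Game.Holds, QF.eval_rename, QF.Eval, Fin.snoc_comp_castSucc]⟩

theorem atom (w : Fin k → Fin n) : GameDef n fun _ _ X v => v ∘ w ∈ X :=
  ⟨.leaf (.not .tru) .tru w, fun M _ B X v => by simp [Game.Holds, QF.Eval]⟩

theorem const (c : Prop) : GameDef (k := k) n fun _ _ _ _ => c := by
  by_cases hc : c
  · exact (qf .tru).congr fun _ _ _ _ _ => by simp [QF.Eval, hc]
  · exact (qf (.not .tru)).congr fun _ _ _ _ _ => by simp [QF.Eval, hc]

theorem ite_leaf_leaf (g a₁ b₁ a₂ b₂ : QF k n) (w₁ w₂ : Fin k → Fin n) :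
    GameDef n fun _ B X v => (g.Eval B v ∧ (Game.leaf a₁ b₁ w₁).Holds B X v) ∨
      (¬ g.Eval B v ∧ (Game.leaf a₂ b₂ w₂).Holds B X v) := by
  obtain ⟨e₁, he₁⟩ := QF.exists_eval_iff_comp_eq (k := k) (Fin.natAdd n) (Fin.castAdd k ∘ w₁)
  obtain ⟨e₂, he₂⟩ := QF.exists_eval_iff_comp_eq (k := k) (Fin.natAdd n) (Fin.castAdd k ∘ w₂)
  let up : QF k n → QF k (n + k) := QF.rename (Fin.castAdd k)
  have key : GameDef (n + k) fun M B X v => (Game.leaf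
      (((up g).and (up a₁)).or ((up g).not.and (up a₂)))
      (((up g).and ((up b₁).and e₁)).or ((up g).not.and ((up b₂).and e₂)))
      (Fin.natAdd n)).Holds B X v := ⟨_, fun _ _ _ _ _ => Iff.rfl⟩
  refine key.exBlock.congr fun M _ B X v => ?_
  have append_left : ∀ z : Fin k → M, Fin.append v z ∘ Fin.castAdd k = v :=
    fun z => funext fun i => Fin.append_left v z i
  have append_right : ∀ z : Fin k → M, Fin.append v z ∘ Fin.natAdd n = z :=
    fun z => funext fun i => Fin.append_right v z i
  simp only [Game.Holds, QF.eval_or, QF.Eval, up, QF.eval_rename, he₁, he₂, append_right,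
    ← Function.comp_assoc, append_left]
  constructor
  · rintro ⟨z, (h | h) | ⟨⟨h₁, h₂, rfl⟩ | ⟨h₁, h₂, rfl⟩, h₃⟩⟩ <;> tauto
  · rintro (⟨h₁, h | h⟩ | ⟨h₁, h | h⟩)
    · exact ⟨v ∘ w₁, by tauto⟩
    · exact ⟨v ∘ w₁, by tauto⟩
    · exact ⟨v ∘ w₂, by tauto⟩
    · exact ⟨v ∘ w₂, by tauto⟩

theorem ite_leaf (g a b : QF k n) (w : Fin k → Fin n) (G : Game k n) :
    GameDef n fun _ B X v => (g.Eval B v ∧ (Game.leaf a b w).Holds B X v) ∨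
      (¬ g.Eval B v ∧ G.Holds B X v) := by
  induction G with
  | leaf a₂ b₂ w₂ => exact ite_leaf_leaf g a b a₂ b₂ w w₂
  | ex G ih =>
    refine (ih (g.rename Fin.castSucc) (a.rename Fin.castSucc) (b.rename Fin.castSucc)
      (Fin.castSucc ∘ w)).ex.congr fun M _ B X v => ?_
    simp only [QF.eval_rename, Game.Holds, Fin.snoc_comp_castSucc, ← Function.comp_assoc]
    simp only [exists_or, exists_and_left, exists_const]
  | all G ih =>
    refine (ih (g.rename Fin.castSucc) (a.rename Fin.castSucc) (b.rename Fin.castSucc)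
      (Fin.castSucc ∘ w)).all.congr fun M _ B X v => ?_
    simp only [QF.eval_rename, Game.Holds, Fin.snoc_comp_castSucc, ← Function.comp_assoc]
    by_cases hg : g.Eval B v <;> simp [hg]

theorem ite_holds (g : QF k n) (G : Game k n) (hΨ : GameDef n Ψ) :
    GameDef n fun M B X v => (g.Eval B v ∧ G.Holds B X v) ∨ (¬ g.Eval B v ∧ Ψ M B X v) := by
  induction G with
  | leaf a b w =>
    obtain ⟨G₂, hG₂⟩ := hΨ
    exact (ite_leaf g a b w G₂).congr fun M _ B X v => by rw [hG₂]
  | ex G ih =>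
    refine (ih (g.rename Fin.castSucc) (hΨ.rename Fin.castSucc)).ex.congr fun M _ B X v => ?_
    simp only [QF.eval_rename, Game.Holds, Fin.snoc_comp_castSucc]
    simp only [exists_or, exists_and_left, exists_const]
  | all G ih =>
    refine (ih (g.rename Fin.castSucc) (hΨ.rename Fin.castSucc)).all.congr fun M _ B X v => ?_
    simp only [QF.eval_rename, Game.Holds, Fin.snoc_comp_castSucc]
    by_cases hg : g.Eval B v <;> simp [hg]

/-- Case distinction on a quantifier-free condition. -/
theorem ite (g : QF k n) (hΦ : GameDef n Φ) (hΨ : GameDef n Ψ) :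
    GameDef n fun M B X v => (g.Eval B v ∧ Φ M B X v) ∨ (¬ g.Eval B v ∧ Ψ M B X v) := by
  obtain ⟨G, hG⟩ := hΦ
  exact (ite_holds g G hΨ).congr fun M _ B X v => by rw [hG]

theorem ite_two (hΦ : GameDef n Φ) (hΨ : GameDef n Ψ) :
    GameDef (n + 1 + 1) fun M B X v =>
      (v (Fin.last n).castSucc = v (Fin.last (n + 1)) ∧ Φ M B X (v ∘ Fin.castSucc ∘ Fin.castSucc)) ∨
      (¬ v (Fin.last n).castSucc = v (Fin.last (n + 1)) ∧
        Ψ M B X (v ∘ Fin.castSucc ∘ Fin.castSucc)) :=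
  ite (.eq _ _) (hΦ.rename _) (hΨ.rename _)

theorem and (hΦ : GameDef n Φ) (hΨ : GameDef n Ψ) :
    GameDef n fun M B X v => Φ M B X v ∧ Ψ M B X v := by
  refine (ite_two hΦ hΨ).all.all.congr fun M _ B X v => ?_
  simp only [Fin.snoc_castSucc, Fin.snoc_last, ← Function.comp_assoc, Fin.snoc_comp_castSucc]
  obtain ⟨x, y, hxy⟩ := exists_pair_ne M
  exact ⟨fun h => ⟨((h x x).resolve_right fun h => h.1 rfl).2,
    ((h x y).resolve_left fun h => hxy h.1).2⟩, fun h x y => by tauto⟩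

theorem or (hΦ : GameDef n Φ) (hΨ : GameDef n Ψ) :
    GameDef n fun M B X v => Φ M B X v ∨ Ψ M B X v := by
  refine (ite_two hΦ hΨ).ex.ex.congr fun M _ B X v => ?_
  simp only [Fin.snoc_castSucc, Fin.snoc_last, ← Function.comp_assoc, Fin.snoc_comp_castSucc]
  obtain ⟨x, y, hxy⟩ := exists_pair_ne M
  refine ⟨fun ⟨_, _, h⟩ => by tauto, ?_⟩
  rintro (h | h)
  · exact ⟨x, x, Or.inl ⟨rfl, h⟩⟩
  · exact ⟨x, y, Or.inr ⟨hxy, h⟩⟩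

theorem forall_finite {α : Type} [Finite α]
    {Φ : α → ∀ M : Type, Set (Fin k → M) → Set (Fin k → M) → (Fin n → M) → Prop}
    (hΦ : ∀ a, GameDef n (Φ a)) : GameDef n fun M B X v => ∀ a, Φ a M B X v := by
  suffices h : ∀ s : Set α, s.Finite → GameDef n fun M B X v => ∀ a ∈ s, Φ a M B X v from
    (h Set.univ Set.finite_univ).congr fun M _ B X v => by simp
  intro s hs
  induction s, hs using Set.Finite.induction_on with
  | empty => exact (const True).congr fun M _ B X v => by simp
  | @insert a _ _ _ ih => exact ((hΦ a).and ih).congr fun M _ B X v => by simp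

theorem exists_finite {α : Type} [Finite α]
    {Φ : α → ∀ M : Type, Set (Fin k → M) → Set (Fin k → M) → (Fin n → M) → Prop}
    (hΦ : ∀ a, GameDef n (Φ a)) : GameDef n fun M B X v => ∃ a, Φ a M B X v := by
  suffices h : ∀ s : Set α, s.Finite → GameDef n fun M B X v => ∃ a ∈ s, Φ a M B X v from
    (h Set.univ Set.finite_univ).congr fun M _ B X v => by simp
  intro s hs
  induction s, hs using Set.Finite.induction_on with
  | empty => exact (const False).congr fun M _ B X v => by simp
  | @insert a _ _ _ ih => exact ((hΦ a).or ih).congr fun M _ B X v => by simp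

theorem addPoint_holds (G : Game k n) (z : Fin k → Fin n) :
    GameDef n fun _ B X v => G.Holds B (insert (v ∘ z) X) v := by
  induction G with
  | leaf a b w =>
    obtain ⟨e, he⟩ := QF.exists_eval_iff_comp_eq (k := k) w z
    refine ⟨.leaf (a.or (b.and e)) b w, fun M _ B X v => ?_⟩
    simp only [Game.Holds, QF.eval_or, QF.Eval, he, Set.mem_insert_iff]
    tauto
  | ex G ih =>
    refine (ih (Fin.castSucc ∘ z)).ex.congr fun M _ B X v => ?_
    simp only [← Function.comp_assoc, Fin.snoc_comp_castSucc]
    rfl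
  | all G ih =>
    refine (ih (Fin.castSucc ∘ z)).all.congr fun M _ B X v => ?_
    simp only [← Function.comp_assoc, Fin.snoc_comp_castSucc]
    rfl

theorem addPoint (hΦ : GameDef n Φ) (z : Fin k → Fin n) :
    GameDef n fun M B X v => Φ M B (insert (v ∘ z) X) v := by
  obtain ⟨G, hG⟩ := hΦ
  exact (addPoint_holds G z).congr fun M _ B X v => hG M B _ v

theorem le_rankType (r : ℕ) (τ : RankType k r n) :
    GameDef n fun _ _ X v => RankType.Le r τ (rankType X r v) := by
  induction r generalizing n with
  | zero =>
    have h_eq : ∀ i j : Fin n, GameDef (k := k) n fun _ _ _ v => (τ.1 i j ↔ v i = v j) := by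
      intro i j
      by_cases h : τ.1 i j
      · exact (qf (.eq i j)).congr fun M _ B X v => by simp [QF.Eval, h]
      · exact (qf (.not (.eq i j))).congr fun M _ B X v => by simp [QF.Eval, h]
    have h_rel : ∀ w : Fin k → Fin n, GameDef (k := k) n fun _ _ X v => ¬ τ.2 w ∨ v ∘ w ∈ X :=
      fun w => (const _).or (atom w)
    refine ((forall_finite fun i => forall_finite fun j => h_eq i j).and
      (forall_finite h_rel)).congr fun M _ B X v => ?_
    simp only [RankType.Le, rankType, funext_iff, eq_iff_iff, imp_iff_not_or]
  | succ r ih =>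
    have := RankType.finite k r (n + 1)
    have h₁ := forall_finite fun σ : RankType k r (n + 1) =>
      (const (k := k) (¬ (show Set _ from τ) σ)).or (ih σ).ex
    have h₂ := (exists_finite fun σ : RankType k r (n + 1) =>
      (const (k := k) ((show Set _ from τ) σ)).and (ih σ)).all
    refine (h₁.and h₂).congr fun M _ B X v => and_congr ?_ ?_
    · refine forall_congr' fun σ => ?_
      rw [← imp_iff_not_or]
      exact imp_congr_right fun _ => ⟨fun ⟨x, hx⟩ => ⟨_, ⟨x, rfl⟩, hx⟩,
        fun ⟨_, ⟨x, hx⟩, h⟩ => ⟨x, by subst hx; exact h⟩⟩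
    · refine ⟨fun h _ ⟨x, hx⟩ => ?_, fun h x => h _ ⟨x, rfl⟩⟩
      obtain ⟨σ, hσ⟩ := h x
      exact ⟨σ, hx ▸ hσ⟩

end GameDef

theorem nontrivial_of_rankType_eq [Nonempty M] [Nonempty N] {X : Set (Fin k → M)}
    {Y : Set (Fin k → N)} {r : ℕ} (hr : 2 ≤ r)
    (h : rankType X r (Fin.elim0 : Fin 0 → M) = rankType Y r (Fin.elim0 : Fin 0 → N))
    (hM : Nontrivial M) : Nontrivial N := by
  obtain ⟨x, y, hxy⟩ := exists_pair_ne M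
  obtain ⟨x', hx'⟩ := (rankType_succ_eq_iff.1 (rankType_eq_of_le hr h)).1 x
  obtain ⟨y', hy'⟩ := (rankType_succ_eq_iff.1 hx').1 y
  refine ⟨x', y', fun hxy' => hxy ?_⟩
  have := (rankType_zero_eq_iff.1 hy').1 (Fin.last 0).castSucc (Fin.last 1)
  simp only [Fin.snoc_castSucc, Fin.snoc_last] at this
  exact this.2 hxy'

/-- The models of `U` with at least two elements are determined by types of some rank. -/
def NontrivialDetermined (U : ∀ M : Type, Set (Fin k → M) → Prop) : Prop :=
  ∃ r, Determined r fun M X => Nontrivial M ∧ U M X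

namespace NontrivialDetermined

variable {U : ∀ M : Type, Set (Fin k → M) → Prop}

theorem of_determined {r : ℕ} (hU : Determined r U) : NontrivialDetermined U :=
  ⟨max r 2, fun M N _ _ _ _ h ⟨hM, H⟩ =>
    ⟨nontrivial_of_rankType_eq (le_max_right _ _) h hM,
      hU M N _ _ (rankType_eq_of_le (le_max_left _ _) h) H⟩⟩

theorem congr {V : ∀ M : Type, Set (Fin k → M) → Prop} (hU : NontrivialDetermined U)
    (h : ∀ (M : Type) [Nontrivial M] (X : Set (Fin k → M)), U M X ↔ V M X) :
    NontrivialDetermined V := by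
  obtain ⟨r, hr⟩ := hU
  refine ⟨r, fun M N _ _ X Y hXY ⟨hM, H⟩ => ?_⟩
  obtain ⟨hN, H'⟩ := hr M N X Y hXY ⟨hM, (h M X).2 H⟩
  exact ⟨hN, (h N Y).1 H'⟩

theorem not (hU : NontrivialDetermined U) : NontrivialDetermined fun M X => ¬ U M X := by
  obtain ⟨r, hr⟩ := hU
  refine ⟨max r 2, fun M N _ _ X Y h ⟨hM, H⟩ =>
    ⟨nontrivial_of_rankType_eq (le_max_right _ _) h hM, fun H' => H ?_⟩⟩
  exact (hr N M Y X (rankType_eq_of_le (le_max_left _ _) h).symm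
    ⟨nontrivial_of_rankType_eq (le_max_right _ _) h hM, H'⟩).2

theorem gameDef (hU : NontrivialDetermined U)
    (h_up : ∀ (M : Type) [Nontrivial M] (X Y : Set (Fin k → M)), X ⊆ Y → U M X → U M Y) :
    GameDef 0 fun M _ X _ => U M X := by
  obtain ⟨r, hr⟩ := hU
  obtain ⟨m, hm⟩ := exists_rank_le_preserved hr
    fun M _ X Y hXY ⟨hM, H⟩ => ⟨hM, h_up M X Y hXY H⟩
  have := RankType.finite k m 0
  refine (GameDef.exists_finite fun τ : RankType k m 0 =>
    (GameDef.const (∃ (M : Type) (_ : Nontrivial M) (X : Set (Fin k → M)), U M X ∧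
      rankType X m (Fin.elim0 : Fin 0 → M) = τ)).and (GameDef.le_rankType m τ)).congr
    fun N _ _ Y v => ?_
  rw [Subsingleton.elim v Fin.elim0]
  constructor
  · rintro ⟨_, ⟨M, hM, X, H, rfl⟩, h⟩
    exact (hm M N X Y h ⟨hM, H⟩).2
  · exact fun H => ⟨_, ⟨N, ‹_›, Y, H, rfl⟩, le_rankType_refl _ _ _⟩

end NontrivialDetermined

theorem GameDef.nontrivialDetermined {D : Dependency k} (hdc : D.DownwardsClosed)
    (hsfo : StronglyFirstOrder D)
    {Φ : ∀ M : Type, Set (Fin k → M) → Set (Fin k → M) → (Fin 0 → M) → Prop}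
    (hΦ : GameDef 0 Φ) :
    NontrivialDetermined fun M B => ∃ X, D.Mem M X ∧ Φ M B X Fin.elim0 := by
  obtain ⟨G, hG⟩ := hΦ
  obtain ⟨r, hr⟩ := G.exists_determined hdc hsfo
  exact (NontrivialDetermined.of_determined hr).congr fun M _ B =>
    exists_congr fun X => and_congr_right fun _ => hG M B X _

theorem GameDef.forall_tuple
    {Φ : ∀ M : Type, Set (Fin k → M) → Set (Fin k → M) → (Fin k → M) → Prop}
    (hΦ : GameDef k Φ) : GameDef 0 fun M B X _ => ∀ z : Fin k → M, Φ M B X z := by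
  refine (hΦ.rename (Fin.natAdd 0)).allBlock.congr fun M _ B X v => ?_
  have append_right : ∀ z : Fin k → M, Fin.append v z ∘ Fin.natAdd 0 = z :=
    fun z => funext fun i => Fin.append_right v z i
  simp only [append_right]

theorem GameDef.param_notMem {n : ℕ} (w : Fin k → Fin n) : GameDef n fun _ B _ v => v ∘ w ∉ B :=
  GameDef.qf (.not (.rel w))

theorem nontrivialDetermined_mem {D : Dependency k} (hdc : D.DownwardsClosed)
    (hsfo : StronglyFirstOrder D) : NontrivialDetermined D.Mem :=
  (((GameDef.param_notMem id).or (GameDef.atom id)).forall_tuple.nontrivialDetermined hdc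
    hsfo).congr fun M _ B => by
      constructor
      · rintro ⟨X, hX, h⟩
        exact hdc _ _ _ hX fun z hz => (h z).resolve_left fun h => h hz
      · exact fun h => ⟨B, h, fun z => (em _).symm⟩

theorem gameDef_insert_notMem {D : Dependency k} (hdc : D.DownwardsClosed)
    (hsfo : StronglyFirstOrder D) : GameDef k fun M _ X z => ¬ D.Mem M (insert z X) :=
  ((((nontrivialDetermined_mem hdc hsfo).not.gameDef fun _ _ _ _ hXY hX hY =>
    hX (hdc _ _ _ hY hXY)).rename Fin.elim0).addPoint id)

/-- The relation `B` is contained in a relation of `D` that has no one-point extension in `D`. -/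
def HasMaximal (D : Dependency k) (M : Type) (B : Set (Fin k → M)) : Prop :=
  ∃ X, D.Mem M X ∧ B ⊆ X ∧ ∀ z, z ∈ X ∨ ¬ D.Mem M (insert z X)

theorem gameDef_not_hasMaximal {D : Dependency k} (hdc : D.DownwardsClosed)
    (hsfo : StronglyFirstOrder D) : GameDef 0 fun M _ X _ => ¬ HasMaximal D M X := by
  have key : NontrivialDetermined (HasMaximal D) :=
    (((((GameDef.param_notMem id).or (GameDef.atom id)).and
      ((GameDef.atom id).or (gameDef_insert_notMem hdc hsfo))).forall_tuple).nontrivialDetermined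
      hdc hsfo).congr fun M _ B => by
        refine exists_congr fun X => and_congr_right fun _ => ?_
        rw [forall_and]
        exact and_congr_left fun _ => forall_congr' fun z => imp_iff_not_or.symm
  exact key.not.gameDef fun _ _ _ _ hXY hX ⟨Z, hZ, hYZ, h⟩ => hX ⟨Z, hZ, hXY.trans hYZ, h⟩

/-- Some relation in `D` without maximal extension decides the points of `B` positively, unless
adding them leads out of `D`. -/
def Absorbs (D : Dependency k) (M : Type) (B : Set (Fin k → M)) : Prop :=
  ∃ X, D.Mem M X ∧ ¬ HasMaximal D M X ∧ ∀ z ∈ B, z ∈ X ∨ ¬ D.Mem M (insert z X)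

theorem nontrivialDetermined_absorbs {D : Dependency k} (hdc : D.DownwardsClosed)
    (hsfo : StronglyFirstOrder D) : NontrivialDetermined (Absorbs D) :=
  ((gameDef_not_hasMaximal hdc hsfo).and ((GameDef.param_notMem id).or
    ((GameDef.atom id).or (gameDef_insert_notMem hdc hsfo))).forall_tuple).nontrivialDetermined
    hdc hsfo |>.congr fun M _ B => by
      refine exists_congr fun X => and_congr_right fun _ => and_congr_right fun _ =>
        forall_congr' fun z => imp_iff_not_or.symm

theorem Absorbs.insert {D : Dependency k} (hdc : D.DownwardsClosed) {B : Set (Fin k → M)}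
    (h : Absorbs D M B) (z : Fin k → M) : Absorbs D M (insert z B) := by
  obtain ⟨X, hX, hmax, hB⟩ := h
  by_cases hz : D.Mem M (Insert.insert z X)
  · refine ⟨Insert.insert z X, hz,
      fun ⟨Y, hY, hXY, h⟩ => hmax ⟨Y, hY, (Set.subset_insert _ _).trans hXY, h⟩, ?_⟩
    rintro w (rfl | hw)
    · exact Or.inl (Set.mem_insert _ _)
    · refine (hB w hw).imp (Set.mem_insert_of_mem _) fun h₁ h₂ => h₁ (hdc _ _ _ h₂ ?_)
      exact Set.insert_subset_insert (Set.subset_insert _ _)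
  · refine ⟨X, hX, hmax, ?_⟩
    rintro w (rfl | hw)
    · exact Or.inr hz
    · exact hB w hw

theorem not_absorbs_univ {D : Dependency k} : ¬ Absorbs D M Set.univ :=
  fun ⟨X, hX, hmax, h⟩ => hmax ⟨X, hX, subset_rfl, fun z => h z trivial⟩

/-- Membership in `B` depends only on the equalities among the coordinates and between coordinates
and elements of `C`. -/
def SupportedBy (C : Set M) (B : Set (Fin k → M)) : Prop :=
  ∀ x y : Fin k → M, (∀ i j, x i = x j ↔ y i = y j) → (∀ i, ∀ c ∈ C, x i = c ↔ y i = c) →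
    (x ∈ B ↔ y ∈ B)

theorem SupportedBy.mono {C C' : Set M} {B : Set (Fin k → M)} (h : SupportedBy C B)
    (hC : C ⊆ C') : SupportedBy C' B :=
  fun x y h₁ h₂ => h x y h₁ fun i c hc => h₂ i c (hC hc)

theorem SupportedBy.union {C : Set M} {B B' : Set (Fin k → M)} (h : SupportedBy C B)
    (h' : SupportedBy C B') : SupportedBy C (B ∪ B') :=
  fun x y h₁ h₂ => or_congr (h x y h₁ h₂) (h' x y h₁ h₂)

/-- The tuples with the prescribed coordinates. -/
def slice (f : Fin k → Option M) : Set (Fin k → M) := {x | ∀ i, ∀ c ∈ f i, x i = c}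

theorem mem_slice_update {f : Fin k → Option M} {i : Fin k} (hi : f i = none) {p : M}
    {x : Fin k → M} : x ∈ slice (Function.update f i (some p)) ↔ x ∈ slice f ∧ x i = p := by
  constructor
  · refine fun h => ⟨fun j c hc => ?_, h i p (by simp)⟩
    have hj : j ≠ i := by
      rintro rfl
      simp [hi] at hc
    exact h j c (by rwa [Function.update_of_ne hj])
  · rintro ⟨h, hp⟩ j c hc
    by_cases hj : j = i
    · subst hj
      simp only [Function.update_self, Option.mem_def, Option.some.injEq] at hc
      exact hp.trans hc
    · rw [Function.update_of_ne hj] at hc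
      exact h j c hc

theorem supportedBy_slice {C : Set M} {f : Fin k → Option M} (hf : ∀ i, ∀ c ∈ f i, c ∈ C) :
    SupportedBy C (slice f) :=
  fun _ _ _ h₂ => forall_congr' fun i => forall₂_congr fun c hc => h₂ i c (hf i c hc)

/-- The tuples `a` and `b` realize the same equalities among themselves and with `C`, where
membership in `S` on the left corresponds to membership in `T` on the right. -/
structure Similar (C S T : Set M) {n : ℕ} (a b : Fin n → M) : Prop where
  eq_iff : ∀ i j, a i = a j ↔ b i = b j
  const_iff : ∀ i, ∀ c ∈ C, a i = c ↔ b i = c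
  mem_iff : ∀ i, a i ∈ S ↔ b i ∈ T

theorem Similar.symm {C S T : Set M} {n : ℕ} {a b : Fin n → M} (h : Similar C S T a b) :
    Similar C T S b a :=
  ⟨fun i j => (h.1 i j).symm, fun i c hc => (h.2 i c hc).symm, fun i => (h.3 i).symm⟩

theorem Similar.snoc {C S T : Set M} {n : ℕ} {a b : Fin n → M} (h : Similar C S T a b) {x y : M}
    (h₁ : ∀ i, a i = x ↔ b i = y) (h₂ : ∀ c ∈ C, x = c ↔ y = c) (h₃ : x ∈ S ↔ y ∈ T) :
    Similar C S T (Fin.snoc a x : Fin (n + 1) → M) (Fin.snoc b y : Fin (n + 1) → M) := by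
  refine ⟨fun i j => ?_, fun i c hc => ?_, fun i => ?_⟩
  · induction i using Fin.lastCases with
    | last =>
      induction j using Fin.lastCases with
      | last => simp
      | cast j => simpa [eq_comm] using h₁ j
    | cast i =>
      induction j using Fin.lastCases with
      | last => simpa using h₁ i
      | cast j => simpa using h.1 i j
  · induction i using Fin.lastCases with
    | last => simpa using h₂ c hc
    | cast i => simpa using h.2 i c hc
  · induction i using Fin.lastCases with
    | last => simpa using h₃
    | cast i => simpa using h.3 i

/-- The set `S` has an element outside of every set of fewer than `N` elements. -/
def LargeFor (N : ℕ) (S : Set M) : Prop := ∀ t : Finset M, t.card < N → ∃ y ∈ S, y ∉ t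

theorem Similar.exists_snoc {C S T : Set M} (hS : Disjoint S C) (hT : Disjoint T C) {N n : ℕ}
    (hT_large : LargeFor N T) (hT'_large : LargeFor N (T ∪ C)ᶜ) (hn : n < N) {a b : Fin n → M}
    (h : Similar C S T a b) (x : M) : ∃ y,
      Similar C S T (Fin.snoc a x : Fin (n + 1) → M) (Fin.snoc b y : Fin (n + 1) → M) := by
  classical
  by_cases hx : ∃ i, a i = x
  · obtain ⟨i, rfl⟩ := hx
    exact ⟨b i, h.snoc (fun j => h.1 j i) (h.2 i) (h.3 i)⟩
  by_cases hC : x ∈ C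
  · exact ⟨x, h.snoc (fun i => h.2 i x hC) (fun _ _ => Iff.rfl)
      (iff_of_false (fun h => hS.le_bot ⟨h, hC⟩) fun h => hT.le_bot ⟨h, hC⟩)⟩
  obtain ⟨y, hy, hyC, hyT⟩ : ∃ y, (∀ i, b i ≠ y) ∧ y ∉ C ∧ (x ∈ S ↔ y ∈ T) := by
    have hcard : (Finset.univ.image b).card < N :=
      (Finset.card_image_le.trans_eq (by simp)).trans_lt hn
    by_cases hxS : x ∈ S
    · obtain ⟨y, hy, hyb⟩ := hT_large _ hcard
      exact ⟨y, by simpa using hyb, fun hC => hT.le_bot ⟨hy, hC⟩, iff_of_true hxS hy⟩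
    · obtain ⟨y, hy, hyb⟩ := hT'_large _ hcard
      exact ⟨y, by simpa using hyb, fun hC => hy (Or.inr hC),
        iff_of_false hxS fun h => hy (Or.inl h)⟩
  refine ⟨y, h.snoc (fun i => iff_of_false (fun h => hx ⟨i, h⟩) (hy i)) (fun c hc => ?_) hyT⟩
  exact iff_of_false (fun h => hC (h ▸ hc)) fun h => hyC (h ▸ hc)

theorem rankType_union_slice_eq {C S T : Set M} (hS : Disjoint S C) (hT : Disjoint T C) {N : ℕ}
    (hS_large : LargeFor N S) (hS'_large : LargeFor N (S ∪ C)ᶜ)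
    (hT_large : LargeFor N T) (hT'_large : LargeFor N (T ∪ C)ᶜ)
    {B : Set (Fin k → M)} (hB : SupportedBy C B) {f : Fin k → Option M}
    (hf : ∀ i, ∀ c ∈ f i, c ∈ C) (i : Fin k) {r n : ℕ} (hn : n + r ≤ N) {a b : Fin n → M}
    (h : Similar C S T a b) :
    rankType (B ∪ {x ∈ slice f | x i ∈ S}) r a = rankType (B ∪ {x ∈ slice f | x i ∈ T}) r b := by
  induction r generalizing n with
  | zero =>
    refine rankType_zero_eq_iff.2 ⟨h.1, fun w => or_congr ?_ (and_congr ?_ (h.3 _))⟩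
    · exact hB _ _ (fun _ _ => h.1 _ _) fun _ => h.2 _
    · exact supportedBy_slice hf _ _ (fun _ _ => h.1 _ _) fun _ => h.2 _
  | succ r ih =>
    refine rankType_succ_eq_iff.2 ⟨fun x => ?_, fun y => ?_⟩
    · obtain ⟨y, hy⟩ := h.exists_snoc hS hT hT_large hT'_large (by omega) x
      exact ⟨y, ih (by omega) hy⟩
    · obtain ⟨x, hx⟩ := h.symm.exists_snoc hT hS hS_large hS'_large (by omega) y
      exact ⟨x, ih (by omega) hx.symm⟩

/-- On an infinite domain, a property of relations that is determined by types of some rank and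
preserved by adding single tuples is preserved by adding slices. -/
theorem union_slice_of_insert [Infinite M] {P : Set (Fin k → M) → Prop} {r : ℕ}
    (h_insert : ∀ B z, P B → P (insert z B))
    (h_rank : ∀ B B' : Set (Fin k → M), rankType B r (Fin.elim0 : Fin 0 → M) =
      rankType B' r (Fin.elim0 : Fin 0 → M) → P B → P B')
    (j : ℕ) (f : Fin k → Option M) (hj : {i | f i = none}.ncard = j) (B : Set (Fin k → M))
    (C : Finset M) (hB : SupportedBy (C : Set M) B) (hPB : P B) : P (B ∪ slice f) := by
  classical
  induction j generalizing f B C with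
  | zero =>
    have hsome : ∀ i, ∃ c, f i = some c := fun i => by
      rw [← Option.ne_none_iff_exists']
      intro hi
      have : i ∈ {i | f i = none} := hi
      rw [(Set.ncard_eq_zero (Set.toFinite _)).1 hj] at this
      exact this
    choose z hz using hsome
    have : slice f = {z} := by
      ext x
      simp [slice, hz, funext_iff, eq_comm]
    rw [this, Set.union_comm, Set.singleton_union]
    exact h_insert _ _ hPB
  | succ j ih =>
    obtain ⟨i, hi⟩ : {i | f i = none}.Nonempty := by
      rw [← Set.ncard_pos, hj]
      exact j.succ_pos
    have hupdate : ∀ p, {i' | Function.update f i (some p) i' = none}.ncard = j := fun p => by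
      have : {i' | Function.update f i (some p) i' = none} = {i' | f i' = none} \ {i} := by
        ext i'
        by_cases h : i' = i
        · subst h
          simp
        · simp [h]
      rw [this, Set.ncard_sdiff_singleton_of_mem hi, hj, Nat.add_sub_cancel]
    obtain ⟨V, hV⟩ : ∃ V : Finset M, ∀ i, ∀ c ∈ f i, c ∈ V :=
      ⟨Finset.univ.biUnion fun i => (f i).toFinset, fun i c hc => by
        simpa using ⟨i, hc⟩⟩
    have finite_slices : ∀ (F C : Finset M) (B : Set (Fin k → M)), SupportedBy (C : Set M) B →
        P B → P (B ∪ {x ∈ slice f | x i ∈ F}) := by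
      intro F
      induction F using Finset.induction_on with
      | empty =>
        intro C B _ hPB
        simpa using hPB
      | insert p F _ ihF =>
        intro C B hB hPB
        have h_eq : B ∪ {x ∈ slice f | x i ∈ insert p F} =
            (B ∪ slice (Function.update f i (some p))) ∪ {x ∈ slice f | x i ∈ F} := by
          ext x
          simp only [Set.mem_union, mem_slice_update hi, Finset.mem_insert, Set.mem_ofPred_eq]
          tauto
        rw [h_eq]
        refine ihF (C ∪ insert p V) _ ((hB.mono ?_).union (supportedBy_slice ?_))
          (ih _ (hupdate p) B C hB hPB)
        · rw [Finset.coe_union]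
          exact Set.subset_union_left
        intro i' c hc
        by_cases h : i' = i
        · subst h
          simp_all
        · rw [Function.update_of_ne h] at hc
          simp [hV i' c hc]
    let K := C ∪ V
    have hBK : SupportedBy (K : Set M) B := hB.mono (by simp [K])
    have hfK : ∀ i, ∀ c ∈ f i, c ∈ (K : Set M) := fun i c hc => by simp [K, hV i c hc]
    obtain ⟨F, hFK, hF⟩ := (K.finite_toSet.infinite_compl).exists_subset_card_eq r
    let T : Set M := ((F : Set M) ∪ K)ᶜ
    have hFdisj : Disjoint (F : Set M) K := Set.disjoint_left.2 fun x hx => hFK hx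
    have hTdisj : Disjoint T K := Set.disjoint_left.2 fun x hx hK => hx (Or.inr hK)
    have hF_large : LargeFor r (F : Set M) := fun t ht =>
      Finset.exists_mem_notMem_of_card_lt_card (ht.trans_eq hF.symm)
    have hT_large : LargeFor r T := fun t _ => by
      obtain ⟨y, hy⟩ := Infinite.exists_notMem_finset (t ∪ F ∪ K)
      simp only [Finset.mem_union, not_or] at hy
      exact ⟨y, by simp [T, hy], hy.1.1⟩
    have hT' : (T ∪ K)ᶜ = F := by
      ext x
      have : x ∈ F → x ∉ K := fun h => by simpa using hFK h
      simp only [T, Set.mem_compl_iff, Set.mem_union, Finset.mem_coe]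
      tauto
    have key := h_rank _ _ (rankType_union_slice_eq hFdisj hTdisj hF_large hT_large hT_large
      (hT'.symm ▸ hF_large) hBK hfK i (zero_add r).le
      (a := Fin.elim0) (b := Fin.elim0) ⟨nofun, nofun, nofun⟩) (finite_slices F C B hB hPB)
    have hsupp : SupportedBy ((F ∪ K : Finset M) : Set M) (B ∪ {x ∈ slice f | x i ∈ T}) := by
      refine (hBK.mono (by simp)).union fun x y h₁ h₂ => and_congr ?_ (not_congr ?_)
      · exact supportedBy_slice (fun i c hc => by simpa using Or.inr (hfK i c hc)) _ _ h₁ h₂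
      · rw [← Finset.coe_union]
        exact ⟨fun h => ((h₂ i _ h).1 rfl).symm ▸ h, fun h => ((h₂ i _ h).2 rfl).symm ▸ h⟩
    have := finite_slices (F ∪ K) _ _ hsupp key
    convert this using 1
    ext x
    simp only [T, Set.mem_union, Set.mem_ofPred_eq, Set.mem_compl_iff, Finset.mem_coe,
      Finset.mem_union]
    tauto

theorem univ_of_insert [Infinite M] {P : Set (Fin k → M) → Prop} {r : ℕ}
    (h_insert : ∀ B z, P B → P (insert z B))
    (h_rank : ∀ B B' : Set (Fin k → M), rankType B r (Fin.elim0 : Fin 0 → M) =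
      rankType B' r (Fin.elim0 : Fin 0 → M) → P B → P B') (h : P ∅) : P Set.univ := by
  have := union_slice_of_insert h_insert h_rank _ (fun _ => none) rfl ∅ ∅ (fun _ _ _ _ => Iff.rfl) h
  have h_eq : (∅ : Set (Fin k → M)) ∪ slice (fun _ => none) = Set.univ := by
    ext x
    simp [slice]
  rwa [h_eq] at this

theorem hasMaximal_of_mem {D : Dependency k} (hdc : D.DownwardsClosed) (hsfo : StronglyFirstOrder D)
    {R : Set (Fin k → M)} (hR : D.Mem M R) : HasMaximal D M R := by
  cases finite_or_infinite M
  · obtain ⟨X, hRX, hX⟩ := (Set.toFinite {X | D.Mem M X}).exists_le_maximal hR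
    refine ⟨X, hX.1, hRX, fun z => or_iff_not_imp_right.2 fun hz => ?_⟩
    exact hX.2 (not_not.1 hz) (Set.subset_insert _ _) (Set.mem_insert _ _)
  · by_contra hmax
    obtain ⟨r, hr⟩ := nontrivialDetermined_absorbs hdc hsfo
    refine not_absorbs_univ (univ_of_insert (P := Absorbs D M) (r := r)
      (fun B z h => h.insert hdc z)
      (fun B B' h hB => (hr M M B B' h ⟨inferInstance, hB⟩).2) ⟨R, hR, hmax, ?_⟩)
    simp

end NonJumping

/-- If `D` is downwards closed and strongly first order, then `D` is non-jumping:
whenever `(M, R) ∈ D`, there is some `R' ⊇ R` with `(M, R') ∈ D_max` and `(M, S) ∈ D`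
for all `S` with `R ⊆ S ⊆ R'`. -/
theorem downwardsClosed_nonJumping {k : ℕ} (D : Dependency k)
    (hdc : D.DownwardsClosed) (hsfo : StronglyFirstOrder D)
    (M : Type) (hne : Nonempty M) (R : Set (Fin k → M)) (hR : D.Mem M R) :
    ∃ R' : Set (Fin k → M), R ⊆ R' ∧ D.MaxAt M R' ∧
      ∀ S : Set (Fin k → M), R ⊆ S → S ⊆ R' → D.Mem M S := by
  obtain ⟨R', hR', hRR', hmax⟩ := NonJumping.hasMaximal_of_mem hdc hsfo hR
  refine ⟨R', hRR', ⟨hR', fun ⟨S, hS, hSD⟩ => ?_⟩, fun S _ hS => hdc _ _ _ hR' hS⟩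
  obtain ⟨z, hzS, hzR'⟩ := Set.exists_of_ssubset hS
  exact (hmax z).elim hzR' fun h => h (hdc _ _ _ hSD (Set.insert_subset hzS hS.subset))
end

section
/- Let D be a k-ary dependency, and let M be a model whose signature contains a binary predicate <, a (k+1)-ary predicate Ŝ, and a constant d, and for each element i of M let S_i = {m⃗ ∈ M^k : M ⊨ Ŝ i m⃗}. Then M satisfies the FO(D) sentence ∃t (t < d ∧ ∀w⃗(¬Ŝ t w⃗ ∨ (Ŝ t w⃗ ∧ D w⃗))) under team semantics if and only if there exists a nonempty set I of elements of M such that i < d for all i ∈ I and (M, ⋃_{i∈I} S_i) ∈ D. -/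
open FirstOrder FirstOrder.Language

variable {L : FirstOrder.Language.{0,0}} {ι : Type} {Ds : ι → (k : ℕ) × Dependency k}

variable {k : ℕ}

/-- Nested universal quantification `∀ v₁ … ∀ vₙ φ` over a list of variables. -/
def faList {L : FirstOrder.Language.{0,0}} {ι : Type} {Ds : ι → (k : ℕ) × Dependency k}
    (vs : List ℕ) (φ : TSFormula L Ds) : TSFormula L Ds :=
  vs.foldr (fun v ψ => .fa v ψ) φ

/-- The tuple of variables `w⃗ = (1, …, k)`. -/
def wVars (k : ℕ) : Fin k → ℕ := fun j => (j : ℕ) + 1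

/-- The tuple of terms `(t, w⃗) = (var 0, var 1, …, var k)` used as arguments of `Ŝ`. -/
def sArgs (L : FirstOrder.Language.{0,0}) (k : ℕ) : Fin (k + 1) → L.Term ℕ :=
  fun j => Term.var (Fin.cases 0 (fun i : Fin k => (i : ℕ) + 1) j)

/-- The `FO(D)` sentence `∃t (t < d ∧ ∀w⃗(¬Ŝ t w⃗ ∨ (Ŝ t w⃗ ∧ D w⃗)))`, where `t` is variable `0`
and `w⃗` are variables `1, …, k`. -/
def chainSentence (L : FirstOrder.Language.{0,0}) (D : Dependency k)
    (lt : L.Relations 2) (shat : L.Relations (k + 1)) (dC : L.Functions 0) :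
    TSFormula L (fun _ : Unit => ⟨k, D⟩) :=
  .ex 0 (.conj
    (.rel lt ![Term.var 0, Term.func dC Fin.elim0])
    (faList (List.ofFn (wVars k))
      (.disj (.nrel shat (sArgs L k))
        (.conj (.rel shat (sArgs L k)) (.depAtom () (wVars k))))))

/-- Universal quantification over a list of variables lets those variables take arbitrary values. -/
theorem sat_faList_iff {M : Type} [L.Structure M] (φ : TSFormula L Ds) (vs : List ℕ)
    (X : Set (ℕ → M)) :
    (faList vs φ).Sat M X ↔ φ.Sat M {s' | ∃ s ∈ X, ∀ v, v ∉ vs → s' v = s v} := by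
  induction vs generalizing X with
  | nil =>
    have h : {s' : ℕ → M | ∃ s ∈ X, ∀ v, v ∉ ([] : List ℕ) → s' v = s v} = X := by
      ext s'
      constructor
      · rintro ⟨s, hs, h⟩
        rwa [show s' = s from funext fun v => h v List.not_mem_nil]
      · exact fun hs => ⟨s', hs, fun _ _ => rfl⟩
    rw [h]
    rfl
  | cons u vs ih =>
    change (faList vs φ).Sat M {s' | ∃ s ∈ X, ∃ m : M, s' = Function.update s u m} ↔ _
    rw [ih]
    have h : {s' : ℕ → M | ∃ s ∈ {s' | ∃ s ∈ X, ∃ m : M, s' = Function.update s u m},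
          ∀ v, v ∉ vs → s' v = s v} =
        {s' | ∃ s ∈ X, ∀ v, v ∉ u :: vs → s' v = s v} := by
      ext s'
      constructor
      · rintro ⟨_, ⟨s, hs, m, rfl⟩, h⟩
        refine ⟨s, hs, fun v hv => ?_⟩
        rw [List.mem_cons, not_or] at hv
        rw [h v hv.2, Function.update_of_ne hv.1]
      · rintro ⟨s, hs, h⟩
        refine ⟨_, ⟨s, hs, s' u, rfl⟩, fun v hv => ?_⟩
        by_cases hvu : v = u
        · rw [hvu, Function.update_self]
        · rw [Function.update_of_ne hvu]
          exact h v (by simp [hvu, hv])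
    rw [h]

/-- Relativizing a formula `φ` to a literal, as `¬ R t⃗ ∨ (R t⃗ ∧ φ)`, restricts the team to the
assignments satisfying the literal. -/
theorem sat_nrel_disj_rel_conj_iff {M : Type} [L.Structure M] {n : ℕ} (r : L.Relations n)
    (ts : Fin n → L.Term ℕ) (φ : TSFormula L Ds) (X : Set (ℕ → M)) :
    (TSFormula.disj (.nrel r ts) (.conj (.rel r ts) φ)).Sat M X ↔
      φ.Sat M {s ∈ X | Structure.RelMap r fun i => (ts i).realize s} := by
  constructor
  · rintro ⟨Y, Z, rfl, hY, hZ, hφ⟩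
    have h : {s ∈ Y ∪ Z | Structure.RelMap r fun i => (ts i).realize s} = Z := by
      ext s
      exact ⟨fun hs => hs.1.resolve_left fun hsY => hY s hsY hs.2,
        fun hs => ⟨Or.inr hs, hZ s hs⟩⟩
    rwa [h]
  · intro hφ
    refine ⟨{s ∈ X | ¬ Structure.RelMap r fun i => (ts i).realize s}, _, ?_,
      fun s hs => hs.2, fun s hs => hs.2, hφ⟩
    ext s
    simp only [Set.mem_union, Set.mem_ofPred_eq]
    tauto

theorem realize_sArgs {M : Type} [L.Structure M] (s : ℕ → M) :
    (fun j => (sArgs L k j).realize s) =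
      (Fin.cons (s 0) fun j => s (wVars k j) : Fin (k + 1) → M) := by
  funext j
  refine Fin.cases ?_ (fun i => ?_) j <;> rfl

theorem zero_notMem_ofFn_wVars (k : ℕ) : 0 ∉ List.ofFn (wVars k) := by
  simp [wVars]

/-- Evaluating the body of the chain sentence on the assignments that agree with some `s[i/t]`,
`i ∈ I`, away from `w⃗` yields the union of the sets `S_i`, `i ∈ I`. -/
theorem teamMap_wVars_eq {M : Type} [L.Structure M] (shat : L.Relations (k + 1)) (s : ℕ → M)
    (I : Set M) :
    teamMap {s' ∈ {s' | ∃ s₁ ∈ {s₁ | ∃ i ∈ I, s₁ = Function.update s 0 i},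
        ∀ v, v ∉ List.ofFn (wVars k) → s' v = s₁ v} |
        Structure.RelMap shat fun j => (sArgs L k j).realize s'} (wVars k) =
      {t : Fin k → M | ∃ i ∈ I, Structure.RelMap shat (Fin.cons i t)} := by
  ext t
  constructor
  · rintro ⟨s', ⟨⟨_, ⟨i, hi, rfl⟩, h⟩, hS⟩, rfl⟩
    rw [realize_sArgs, h 0 (zero_notMem_ofFn_wVars k), Function.update_self] at hS
    exact ⟨i, hi, hS⟩
  · rintro ⟨i, hi, hS⟩
    let s' : ℕ → M := fun v =>
      if hv : v - 1 < k ∧ v ≠ 0 then t ⟨v - 1, hv.1⟩ else Function.update s 0 i v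
    have ht : t = fun j => s' (wVars k j) := by
      funext j
      simp [s', wVars]
    refine ⟨s', ⟨⟨_, ⟨i, hi, rfl⟩, fun v hv => dif_neg fun hv' => hv ?_⟩, ?_⟩, ht⟩
    · rw [List.mem_ofFn]
      exact ⟨⟨v - 1, hv'.1⟩, Nat.sub_add_cancel (Nat.pos_of_ne_zero hv'.2)⟩
    · rw [realize_sArgs, ← ht]
      simpa [s'] using hS

theorem sat_chainSentence_iff (D : Dependency k) (lt : L.Relations 2)
    (shat : L.Relations (k + 1)) (dC : L.Functions 0) (M : Type) [L.Structure M] (s : ℕ → M) :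
    (chainSentence L D lt shat dC).Sat M {s} ↔
      ∃ I : Set M, I.Nonempty ∧
        (∀ i ∈ I, Structure.RelMap lt ![i, Structure.funMap dC Fin.elim0]) ∧
        D.Mem M {t : Fin k → M | ∃ i ∈ I, Structure.RelMap shat (Fin.cons i t)} := by
  have hlt (i : M) :
      (fun j => (![Term.var 0, Term.func dC Fin.elim0] j : L.Term ℕ).realize
        (Function.update s 0 i)) = ![i, Structure.funMap dC Fin.elim0] := by
    funext j
    fin_cases j
    · simp
    · simp only [Fin.mk_one, Matrix.cons_val_one, Matrix.cons_val_fin_one, Term.realize_func]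
      congr 1
      exact Subsingleton.elim _ _
  have hbody (I : Set M) :
      (faList (List.ofFn (wVars k)) (.disj (.nrel shat (sArgs L k))
        (.conj (.rel shat (sArgs L k)) (.depAtom () (wVars k)))) :
          TSFormula L (fun _ : Unit => ⟨k, D⟩)).Sat M
        {s₁ | ∃ i ∈ I, s₁ = Function.update s 0 i} ↔
      D.Mem M {t : Fin k → M | ∃ i ∈ I, Structure.RelMap shat (Fin.cons i t)} := by
    rw [sat_faList_iff, sat_nrel_disj_rel_conj_iff, ← teamMap_wVars_eq shat s I]
    rfl
  have hteam (H : (ℕ → M) → Set M) :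
      {s' : ℕ → M | ∃ s₀ ∈ ({s} : Set (ℕ → M)), ∃ m ∈ H s₀, s' = Function.update s₀ 0 m} =
        {s' | ∃ m ∈ H s, s' = Function.update s 0 m} := by
    simp only [Set.mem_singleton_iff, exists_eq_left]
  simp only [chainSentence, TSFormula.Sat.eq_8, TSFormula.Sat.eq_6, TSFormula.Sat.eq_1, hteam,
    hbody]
  constructor
  · rintro ⟨H, hH, hrel, hD⟩
    exact ⟨H s, hH s rfl, fun i hi => hlt i ▸ hrel _ ⟨i, hi, rfl⟩, hD⟩
  · rintro ⟨I, hI, hrel, hD⟩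
    refine ⟨fun _ => I, fun _ _ => hI, ?_, hD⟩
    rintro _ ⟨i, hi, rfl⟩
    exact (hlt i).symm ▸ hrel i hi

/-- **Semantic verification of the chain formula.** Let `D` be a `k`-ary dependency and let `M`
be a model whose signature contains a binary predicate `<`, a `(k+1)`-ary predicate `Ŝ` and a
constant `d`, and for `i ∈ M` let `S_i = {m⃗ ∈ M^k : M ⊨ Ŝ i m⃗}`. Then `M` satisfies the
`FO(D)` sentence `∃t (t < d ∧ ∀w⃗(¬Ŝ t w⃗ ∨ (Ŝ t w⃗ ∧ D w⃗)))` under team semantics iff there is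
a nonempty set `I` of elements of `M` with `i < d` for all `i ∈ I` and `(M, ⋃_{i∈I} S_i) ∈ D`. -/
theorem chainSentence_trueIn_iff (L : FirstOrder.Language.{0,0}) (D : Dependency k)
    (lt : L.Relations 2) (shat : L.Relations (k + 1)) (dC : L.Functions 0)
    (M : Type) [L.Structure M] [Nonempty M] :
    TSFormula.TrueIn M (chainSentence L D lt shat dC) ↔
      ∃ I : Set M, I.Nonempty ∧
        (∀ i ∈ I, Structure.RelMap lt ![i, Structure.funMap dC Fin.elim0]) ∧
        D.Mem M {t : Fin k → M | ∃ i ∈ I, Structure.RelMap shat (Fin.cons i t)} := by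
  simp only [TSFormula.TrueIn, sat_chainSentence_iff, forall_const]
end
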